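/- arXiv:math/0608542 — 5 statements merged into one kernel-verified Lean document; each statement's English description precedes it below -/
import Mathlib

section
/- For ideals J_l (l in an index set L) and K in a polynomial ring K[x_1,...,x_n], the join operation distributes over intersections: (⋂_l J_l) * K = ⋂_l (J_l * K), where the join I * J is defined as the contraction to K[x] of the ideal I(y) + J(z) + ⟨x_i - y_i - z_i : i = 1,...,n⟩ in K[x,y,z]. -/
open MvPolynomial

/-- The join `I * J` of two ideals of `K[x_1,...,x_n]`: the contraction to `K[x]`
(embedded via `x_i ↦ x_i`) of `I(y) + J(z) + ⟨x_i - y_i - z_i⟩` in `K[x,y,z]`. -/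
noncomputable def joinIdeal {K : Type*} [Field K] {n : ℕ}
    (I J : Ideal (MvPolynomial (Fin n) K)) : Ideal (MvPolynomial (Fin n) K) :=
  Ideal.comap (rename (fun i : Fin n => ((0 : Fin 3), i)) :
      MvPolynomial (Fin n) K →ₐ[K] MvPolynomial (Fin 3 × Fin n) K).toRingHom
    (Ideal.map (rename (fun i : Fin n => ((1 : Fin 3), i)) :
        MvPolynomial (Fin n) K →ₐ[K] MvPolynomial (Fin 3 × Fin n) K).toRingHom I ⊔
     Ideal.map (rename (fun i : Fin n => ((2 : Fin 3), i)) :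
        MvPolynomial (Fin n) K →ₐ[K] MvPolynomial (Fin 3 × Fin n) K).toRingHom J ⊔
     Ideal.span {p | ∃ i : Fin n,
       p = X ((0 : Fin 3), i) - X ((1 : Fin 3), i) - X ((2 : Fin 3), i)})

/-- The irrelevant maximal ideal `m = ⟨x_1,...,x_n⟩`. -/
noncomputable def irrelevant (K : Type*) [Field K] (n : ℕ) : Ideal (MvPolynomial (Fin n) K) :=
  Ideal.span (Set.range X)

open scoped TensorProduct

theorem map_coord_mem {A S ι : Type*} [CommRing A] [CommRing S] [Algebra A S]
    (b : Module.Basis ι A S) (I : Ideal A) (s : S) :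
    s ∈ I.map (algebraMap A S) ↔ ∀ k, b.repr s k ∈ I := by
  constructor
  · intro h k
    have h' : s ∈ (I.map (algebraMap A S)).restrictScalars A := h
    rw [← Ideal.smul_top_eq_map] at h'
    induction h' using Submodule.smul_induction_on' with
    | smul r hr n hn =>
      simp only [map_smul, Finsupp.smul_apply, smul_eq_mul]
      exact I.mul_mem_right _ hr
    | add x hx y hy h1 h2 =>
      have e : ∀ z, z ∈ I • (⊤ : Submodule A S) → z ∈ I.map (algebraMap A S) := fun z hz => by
        rw [Ideal.smul_top_eq_map] at hz
        exact hz
      simp only [map_add, Finsupp.add_apply]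
      exact I.add_mem (h1 (e _ hx)) (h2 (e _ hy))
  · intro h
    rw [← b.linearCombination_repr s, Finsupp.linearCombination_apply]
    refine Ideal.sum_mem _ fun k _ => ?_
    change b.repr s k • b k ∈ _
    rw [Algebra.smul_def]
    exact Ideal.mul_mem_right _ _ (Ideal.mem_map_of_mem _ (h k))

theorem tensor_coord_mem {K A B ι : Type*} [Field K] [CommRing A] [CommRing B] [Algebra K A]
    [Algebra K B] (b : Module.Basis ι K B) (I : Ideal A) (s : A ⊗[K] B) :
    s ∈ I.map (Algebra.TensorProduct.includeLeftRingHom : A →+* A ⊗[K] B) ↔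
      ∀ k, (Algebra.TensorProduct.basis A b).repr s k ∈ I :=
  map_coord_mem (Algebra.TensorProduct.basis A b) I s

noncomputable def joinPhi {K : Type*} [Field K] {n : ℕ}
    (J : Ideal (MvPolynomial (Fin n) K)) :
    MvPolynomial (Fin 3 × Fin n) K →ₐ[K]
      (MvPolynomial (Fin n) K ⊗[K] (MvPolynomial (Fin n) K ⧸ J)) :=
  aeval (R := K) (S₁ := MvPolynomial (Fin n) K ⊗[K] (MvPolynomial (Fin n) K ⧸ J))
    fun p : Fin 3 × Fin n => ![(X p.2 : MvPolynomial (Fin n) K) ⊗ₜ[K]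
        (1 : MvPolynomial (Fin n) K ⧸ J) +
      (1 : MvPolynomial (Fin n) K) ⊗ₜ[K] Ideal.Quotient.mk J (X p.2),
      (X p.2 : MvPolynomial (Fin n) K) ⊗ₜ[K] (1 : MvPolynomial (Fin n) K ⧸ J),
      (1 : MvPolynomial (Fin n) K) ⊗ₜ[K] Ideal.Quotient.mk J (X p.2)] p.1

noncomputable def joinInc {K : Type*} [Field K] {n : ℕ}
    (J : Ideal (MvPolynomial (Fin n) K)) :
    MvPolynomial (Fin n) K →+*
      (MvPolynomial (Fin n) K ⊗[K] (MvPolynomial (Fin n) K ⧸ J)) :=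
  Algebra.TensorProduct.includeLeftRingHom

theorem joinInc_coord_mem {K : Type*} [Field K] {n : ℕ}
    (J : Ideal (MvPolynomial (Fin n) K)) (I : Ideal (MvPolynomial (Fin n) K)) (s) :
    s ∈ I.map (joinInc J) ↔ ∀ k, (Algebra.TensorProduct.basis (MvPolynomial (Fin n) K)
    (Module.Basis.ofVectorSpace K (MvPolynomial (Fin n) K ⧸ J))).repr s k ∈ I :=
  tensor_coord_mem (Module.Basis.ofVectorSpace K (MvPolynomial (Fin n) K ⧸ J)) I s

theorem mem_join_iff {K : Type*} [Field K] {n : ℕ}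
    (I J : Ideal (MvPolynomial (Fin n) K)) (f : MvPolynomial (Fin n) K) :
    f ∈ joinIdeal I J ↔
      joinPhi J (rename (fun i : Fin n => ((0 : Fin 3), i)) f) ∈ I.map (joinInc J) := by
  unfold joinIdeal
  rw [Ideal.mem_comap]
  set T := (Ideal.map (rename (fun i : Fin n => ((1 : Fin 3), i)) :
        MvPolynomial (Fin n) K →ₐ[K] MvPolynomial (Fin 3 × Fin n) K).toRingHom I ⊔
     Ideal.map (rename (fun i : Fin n => ((2 : Fin 3), i)) :
        MvPolynomial (Fin n) K →ₐ[K] MvPolynomial (Fin 3 × Fin n) K).toRingHom J ⊔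
     Ideal.span {p | ∃ i : Fin n,
       p = X ((0 : Fin 3), i) - X ((1 : Fin 3), i) - X ((2 : Fin 3), i)}) with hT
  change rename (fun i : Fin n => ((0 : Fin 3), i)) f ∈ T ↔ _
  generalize rename (fun i : Fin n => ((0 : Fin 3), i)) f = p
  have e1 : ∀ a, joinPhi J (rename (fun i : Fin n => ((1 : Fin 3), i)) a) = a ⊗ₜ 1 := by
    have : (joinPhi J).comp (rename (fun i : Fin n => ((1 : Fin 3), i))) =
        Algebra.TensorProduct.includeLeft := by
      ext i
      simp [joinPhi]
    exact fun a => DFunLike.congr_fun this a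
  have e2 : ∀ a, joinPhi J (rename (fun i : Fin n => ((2 : Fin 3), i)) a) =
      1 ⊗ₜ Ideal.Quotient.mk J a := by
    have : (joinPhi J).comp (rename (fun i : Fin n => ((2 : Fin 3), i))) =
        (Algebra.TensorProduct.includeRight).comp (Ideal.Quotient.mkₐ K J) := by
      ext i
      simp [joinPhi]
    exact fun a => DFunLike.congr_fun this a
  constructor
  · intro h
    suffices hle : T ≤ Ideal.comap (joinPhi J) (I.map (joinInc J)) from hle h
    refine sup_le (sup_le ?_ ?_) ?_
    · rw [Ideal.map_le_iff_le_comap]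
      intro a ha
      change joinPhi J (rename _ a) ∈ I.map (joinInc J)
      rw [e1]
      exact Ideal.mem_map_of_mem _ ha
    · rw [Ideal.map_le_iff_le_comap]
      intro a ha
      change joinPhi J (rename _ a) ∈ I.map (joinInc J)
      rw [e2, Ideal.Quotient.eq_zero_iff_mem.mpr ha, TensorProduct.tmul_zero]
      exact Ideal.zero_mem _
    · rw [Ideal.span_le]
      rintro _ ⟨i, rfl⟩
      change joinPhi J _ ∈ I.map (joinInc J)
      have : joinPhi J (X ((0 : Fin 3), i) - X ((1 : Fin 3), i) - X ((2 : Fin 3), i)) = 0 := by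
        simp [joinPhi]
      rw [this]
      exact Ideal.zero_mem _
  · intro h
    let g1 : MvPolynomial (Fin n) K →ₐ[K] (MvPolynomial (Fin 3 × Fin n) K ⧸ T) :=
      (Ideal.Quotient.mkₐ K T).comp (rename (fun i : Fin n => ((1 : Fin 3), i)))
    let g2 : (MvPolynomial (Fin n) K ⧸ J) →ₐ[K] (MvPolynomial (Fin 3 × Fin n) K ⧸ T) :=
      Ideal.Quotient.liftₐ J
        ((Ideal.Quotient.mkₐ K T).comp (rename (fun i : Fin n => ((2 : Fin 3), i))))
        (fun a ha => Ideal.Quotient.eq_zero_iff_mem.mpr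
          (Ideal.mem_sup_left (Ideal.mem_sup_right (Ideal.mem_map_of_mem
            (rename (fun i : Fin n => ((2 : Fin 3), i)) :
        MvPolynomial (Fin n) K →ₐ[K] MvPolynomial (Fin 3 × Fin n) K).toRingHom ha))))
    have hg2 : ∀ i, g2 (Ideal.Quotient.mk J (X i)) = Ideal.Quotient.mk T (X (2, i)) := by
      intro i
      change Ideal.Quotient.mk T (rename _ (X i)) = _
      rw [rename_X]
    have hg1 : ∀ i, g1 (X i) = Ideal.Quotient.mk T (X (1, i)) := by
      intro i
      change Ideal.Quotient.mk T (rename _ (X i)) = _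
      rw [rename_X]
    let ψ := Algebra.TensorProduct.lift g1 g2 (fun _ _ => Commute.all _ _)
    have hψ : ψ.comp (joinPhi J) = Ideal.Quotient.mkₐ K T := by
      ext ⟨j, i⟩
      fin_cases j
      · simp [joinPhi, ψ, hg1, hg2]
        rw [← map_add, eq_comm, Ideal.Quotient.mk_eq_mk_iff_sub_mem]
        refine Ideal.mem_sup_right (Ideal.subset_span ⟨i, ?_⟩)
        ring
      · simp [joinPhi, ψ, hg1]
      · simp [joinPhi, ψ, hg2]
    have hle : (I.map (joinInc J)) ≤ RingHom.ker ψ := by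
      rw [Ideal.map_le_iff_le_comap]
      intro a ha
      change ψ (a ⊗ₜ 1) = 0
      simp only [ψ, Algebra.TensorProduct.lift_tmul, map_one, mul_one]
      exact Ideal.Quotient.eq_zero_iff_mem.mpr
          (Ideal.mem_sup_left (Ideal.mem_sup_left (Ideal.mem_map_of_mem
            (rename (fun i : Fin n => ((1 : Fin 3), i)) :
        MvPolynomial (Fin n) K →ₐ[K] MvPolynomial (Fin 3 × Fin n) K).toRingHom ha)))
    have h0 : ψ (joinPhi J p) = 0 := hle h
    have h1 : ψ (joinPhi J p) = Ideal.Quotient.mk T p := DFunLike.congr_fun hψ p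
    exact Ideal.Quotient.eq_zero_iff_mem.mp (h1.symm.trans h0)

/-- the join distributes over intersections. -/
theorem join_distrib_iInf {K : Type*} [Field K] {n : ℕ} {L : Type*}
    (J : L → Ideal (MvPolynomial (Fin n) K)) (K' : Ideal (MvPolynomial (Fin n) K)) :
    joinIdeal (⨅ l : L, J l) K' = ⨅ l : L, joinIdeal (J l) K' := by
  ext f
  simp only [Ideal.mem_iInf, mem_join_iff, joinInc_coord_mem]
  exact forall_comm
end

section
/- Let p ∈ K^n be a point with maximal ideal m_p = ⟨x_1 - p_1, ..., x_n - p_n⟩ and m the irrelevant maximal ideal. Then the join m_p * m^r equals m_p^r. Moreover, the polynomials (x - p)^a with |a| = r form a Gröbner basis of m_p^r with respect to any term order. -/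
open MvPolynomial

/-- The maximal ideal of the point `p`. -/
noncomputable def pointIdeal {K : Type*} [Field K] {n : ℕ} (p : Fin n → K) :
    Ideal (MvPolynomial (Fin n) K) :=
  Ideal.span {q | ∃ i : Fin n, q = X i - C (p i)}

/-- The affine zero set of an ideal. -/
def zeroSet {K : Type*} [Field K] {n : ℕ} (I : Ideal (MvPolynomial (Fin n) K)) :
    Set (Fin n → K) :=
  {p | ∀ f ∈ I, eval p f = 0}

/-- The symbolic power of a radical ideal, via the Zariski--Nagata description
as the intersection of the `r`-th powers of the maximal ideals of points of `V(I)`. -/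
noncomputable def pointsSymbolicPower {K : Type*} [Field K] {n : ℕ}
    (I : Ideal (MvPolynomial (Fin n) K)) (r : ℕ) : Ideal (MvPolynomial (Fin n) K) :=
  ⨅ (p : Fin n → K) (_ : p ∈ zeroSet I), pointIdeal p ^ r

/-- Leading exponent of a polynomial with respect to a monomial order. -/
noncomputable def leadExp {K : Type*} [Field K] {n : ℕ} (m : MonomialOrder (Fin n))
    (f : MvPolynomial (Fin n) K) : Fin n →₀ ℕ :=
  m.toSyn.symm (f.support.sup (fun d => m.toSyn d))

/-- The initial ideal of `I` with respect to a monomial order. -/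
noncomputable def initialIdeal {K : Type*} [Field K] {n : ℕ} (m : MonomialOrder (Fin n))
    (I : Ideal (MvPolynomial (Fin n) K)) : Ideal (MvPolynomial (Fin n) K) :=
  Ideal.span {q | ∃ f ∈ I, f ≠ 0 ∧ q = monomial (leadExp m f) (1 : K)}

theorem aux_sup_pow {R : Type*} [CommRing R] (A B : Ideal R) (r : ℕ) :
    (A ⊔ B) ^ r ≤ A ⊔ B ^ r := by
  induction r with
  | zero => simp
  | succ k ih =>
    rw [pow_succ, pow_succ]
    refine (Ideal.mul_mono_left ih).trans ?_
    rw [Ideal.sup_mul, Ideal.mul_sup (B ^ k) A B]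
    have h1 : A * (A ⊔ B) ≤ A := Ideal.mul_le_left
    have h2 : B ^ k * A ≤ A := Ideal.mul_le_right
    exact sup_le (h1.trans le_sup_left) (sup_le (h2.trans le_sup_left) le_sup_right)

noncomputable def auxShift {K : Type*} [Field K] {n : ℕ} (p : Fin n → K) :
    MvPolynomial (Fin n) K →ₐ[K] MvPolynomial (Fin n) K :=
  aeval (fun i => X i + C (p i))

theorem auxShift_X {K : Type*} [Field K] {n : ℕ} (p : Fin n → K) (i : Fin n) :
    auxShift p (X i) = X i + C (p i) := by simp [auxShift]

theorem auxShift_neg {K : Type*} [Field K] {n : ℕ} (p : Fin n → K)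
    (f : MvPolynomial (Fin n) K) : auxShift (-p) (auxShift p f) = f := by
  have : (auxShift (-p)).comp (auxShift p) = AlgHom.id K _ := by
    apply MvPolynomial.algHom_ext
    intro i
    have hC : auxShift (-p) (C (p i)) = C (p i) := (auxShift (-p)).commutes (p i)
    simp [auxShift_X, hC]
  exact DFunLike.congr_fun this f

theorem aux_X_add_C_ne {K : Type*} [Field K] {n : ℕ} (i : Fin n) (c : K) :
    (X i + C c : MvPolynomial (Fin n) K) ≠ 0 := by
  intro h
  have := congrArg (eval (fun _ => 1 - c)) h
  simp at this

theorem aux_degree_prod {K : Type*} [Field K] {n : ℕ} (m : MonomialOrder (Fin n))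
    (p : Fin n → K) (a : Fin n → ℕ) :
    m.degree (∏ i, (X i + C (p i)) ^ a i) = Finsupp.equivFunOnFinite.symm a := by
  rw [m.degree_prod (fun i _ => pow_ne_zero _ (aux_X_add_C_ne i (p i)))]
  ext j
  simp [m.degree_pow, m.degree_X_add_C, Finsupp.finsetSum_apply, Finsupp.single_apply]

theorem auxShift_degree_le {K : Type*} [Field K] {n : ℕ} (m : MonomialOrder (Fin n))
    (p : Fin n → K) (f : MvPolynomial (Fin n) K) :
    m.toSyn (m.degree (auxShift p f)) ≤ m.toSyn (m.degree f) := by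
  have h : auxShift p f = ∑ d ∈ f.support, coeff d f • ∏ i, (X i + C (p i)) ^ d i := by
    rw [auxShift, aeval_def, eval₂_eq']
    simp [Algebra.smul_def]
  rw [h]
  refine m.degree_sum_le.trans (Finset.sup_le fun d hd => ?_)
  refine m.degree_smul_le.trans ?_
  rw [aux_degree_prod, show Finsupp.equivFunOnFinite.symm (d : Fin n → ℕ) = d by ext; simp]
  exact m.le_degree hd

theorem auxShift_degree {K : Type*} [Field K] {n : ℕ} (m : MonomialOrder (Fin n))
    (p : Fin n → K) (f : MvPolynomial (Fin n) K) :
    m.degree (auxShift p f) = m.degree f := by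
  apply m.toSyn.injective
  apply le_antisymm (auxShift_degree_le m p f)
  have := auxShift_degree_le m (-p) (auxShift p f)
  rwa [auxShift_neg] at this

theorem auxShift_mem {K : Type*} [Field K] {n : ℕ} (p : Fin n → K) (r : ℕ)
    (f : MvPolynomial (Fin n) K) (hf : f ∈ pointIdeal p ^ r) :
    auxShift p f ∈ idealOfVars (Fin n) K ^ r := by
  have h := Ideal.mem_map_of_mem (auxShift p) hf
  rw [Ideal.map_pow] at h
  refine Ideal.pow_right_mono ?_ r h
  rw [pointIdeal, Ideal.map_span, Ideal.span_le]
  rintro _ ⟨_, ⟨i, rfl⟩, rfl⟩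
  have : auxShift p (X i - C (p i)) = X i := by
    simp [auxShift_X, ← MvPolynomial.algebraMap_eq]
  rw [this]
  exact Ideal.subset_span ⟨i, rfl⟩

theorem aux_prod_mem {K : Type*} [Field K] {n : ℕ} (p : Fin n → K) (a : Fin n → ℕ) :
    (∏ i, (X i - C (p i)) ^ a i) ∈ pointIdeal p ^ (∑ i, a i) := by
  rw [← Finset.prod_pow_eq_pow_sum]
  exact Ideal.prod_mem_prod fun i _ =>
    Ideal.pow_mem_pow (show X i - C (p i) ∈ pointIdeal p from Ideal.subset_span ⟨i, rfl⟩) _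

theorem aux_leadExp {K : Type*} [Field K] {n : ℕ} (m : MonomialOrder (Fin n))
    (p : Fin n → K) (a : Fin n → ℕ) :
    leadExp m (∏ i, (X i - C (p i)) ^ a i) = Finsupp.equivFunOnFinite.symm a := by
  have := aux_degree_prod m (-p) a
  change m.degree _ = _
  simpa [sub_eq_add_neg] using this

theorem aux_join {K : Type*} [Field K] {n : ℕ} (p : Fin n → K) (r : ℕ) :
    joinIdeal (pointIdeal p) (irrelevant K n ^ r) = pointIdeal p ^ r := by
  apply le_antisymm
  · intro f hf
    let ψ : MvPolynomial (Fin 3 × Fin n) K →ₐ[K] MvPolynomial (Fin n) K :=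
      aeval (fun q => if q.1 = 0 then X q.2 else if q.1 = 1 then C (p q.2)
        else X q.2 - C (p q.2))
    have h0 : ∀ i, ψ (X (0, i)) = X i := fun i => by simp [ψ]
    have h1 : ∀ i, ψ (X (1, i)) = C (p i) := fun i => by simp [ψ]
    have h2 : ∀ i, ψ (X (2, i)) = X i - C (p i) := fun i => by simp [ψ]
    have hC : ∀ c, ψ (C c) = C c := fun c => by simp [ψ, MvPolynomial.algebraMap_eq]
    have key : ψ (rename (fun i : Fin n => ((0 : Fin 3), i)) f) = f := by
      have : ψ.comp (rename (fun i : Fin n => ((0 : Fin 3), i))) = AlgHom.id K _ := by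
        apply MvPolynomial.algHom_ext
        intro i
        simp [h0]
      exact DFunLike.congr_fun this f
    rw [← key]
    rw [joinIdeal, Ideal.mem_comap] at hf
    refine (show _ ≤ Ideal.comap ψ.toRingHom (pointIdeal p ^ r) from ?_) hf
    refine sup_le (sup_le ?_ ?_) ?_
    · rw [pointIdeal, Ideal.map_span, Ideal.span_le]
      rintro _ ⟨_, ⟨i, rfl⟩, rfl⟩
      simp [h1, hC]
    · rw [Ideal.map_pow, ← Ideal.map_le_iff_le_comap, Ideal.map_pow]
      refine Ideal.pow_right_mono ?_ r
      rw [irrelevant, Ideal.map_span, Ideal.map_span, Ideal.span_le]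
      rintro _ ⟨_, ⟨_, ⟨i, rfl⟩, rfl⟩, rfl⟩
      refine Ideal.subset_span ⟨i, ?_⟩
      simp [h2]
    · rw [Ideal.span_le]
      rintro _ ⟨i, rfl⟩
      simp [h0, h1, h2]
  · rw [joinIdeal, ← Ideal.map_le_iff_le_comap, Ideal.map_pow, Ideal.map_pow, sup_right_comm]
    refine le_trans (Ideal.pow_right_mono ?_ r) (aux_sup_pow _ _ r)
    conv_lhs => rw [pointIdeal]
    rw [Ideal.map_span, Ideal.span_le]
    rintro _ ⟨_, ⟨i, rfl⟩, rfl⟩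
    have e : (rename (fun i : Fin n => ((0 : Fin 3), i)) :
        MvPolynomial (Fin n) K →ₐ[K] MvPolynomial (Fin 3 × Fin n) K).toRingHom (X i - C (p i))
      = ((rename (fun i : Fin n => ((1 : Fin 3), i)) :
        MvPolynomial (Fin n) K →ₐ[K] MvPolynomial (Fin 3 × Fin n) K).toRingHom (X i - C (p i))
        + (X ((0 : Fin 3), i) - X ((1 : Fin 3), i) - X ((2 : Fin 3), i)))
        + (rename (fun i : Fin n => ((2 : Fin 3), i)) :
        MvPolynomial (Fin n) K →ₐ[K] MvPolynomial (Fin 3 × Fin n) K).toRingHom (X i) := by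
      simp
      ring
    rw [e]
    refine Submodule.add_mem_sup (Submodule.add_mem_sup ?_ ?_) ?_
    · exact Ideal.mem_map_of_mem _ (Ideal.subset_span ⟨i, rfl⟩)
    · exact Ideal.subset_span ⟨i, rfl⟩
    · exact Ideal.mem_map_of_mem _ (Ideal.subset_span ⟨i, rfl⟩)

/-- `m_p * m^r = m_p^r`, and the polynomials `(x-p)^a` with `|a| = r`
form a Groebner basis of `m_p^r` with respect to any term order. -/
theorem join_pointIdeal_pow {K : Type*} [Field K] {n : ℕ} (p : Fin n → K) (r : ℕ) :
    joinIdeal (pointIdeal p) (irrelevant K n ^ r) = pointIdeal p ^ r ∧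
    ∀ m : MonomialOrder (Fin n),
      (∀ a : Fin n → ℕ, (∑ i, a i) = r →
        (∏ i, (X i - C (p i)) ^ a i) ∈ pointIdeal p ^ r) ∧
      Ideal.span {q | ∃ a : Fin n → ℕ, (∑ i, a i) = r ∧
          q = monomial (leadExp m (∏ i, (X i - C (p i)) ^ a i)) (1 : K)}
        = initialIdeal m (pointIdeal p ^ r) := by
  refine ⟨aux_join p r, fun m => ⟨?_, ?_⟩⟩
  · rintro a rfl
    exact aux_prod_mem p a
  · apply le_antisymm
    · rw [Ideal.span_le]
      rintro _ ⟨a, rfl, rfl⟩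
      refine Ideal.subset_span ⟨_, aux_prod_mem p a, ?_, rfl⟩
      refine Finset.prod_ne_zero_iff.2 fun i _ => pow_ne_zero _ ?_
      have := aux_X_add_C_ne i (-p i)
      simpa [sub_eq_add_neg] using this
    · rw [initialIdeal, Ideal.span_le]
      rintro _ ⟨f, hf, hf0, rfl⟩
      have hs := auxShift_mem p r f hf
      have hne : auxShift p f ≠ 0 := by
        intro h
        apply hf0
        rw [← auxShift_neg p f, h, map_zero]
      have hd := (mem_pow_idealOfVars_iff r _).1 hs _ (m.degree_mem_support hne)
      rw [auxShift_degree] at hd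
      have hm := (monomial_mem_pow_idealOfVars_iff r (m.degree f) (one_ne_zero (α := K))).2 hd
      rw [pow_idealOfVars_eq_span] at hm
      refine Ideal.span_mono ?_ hm
      rintro _ ⟨d, hd, rfl⟩
      refine ⟨d, ?_, ?_⟩
      · rw [← Finsupp.degree_eq_sum]; exact hd
      · rw [aux_leadExp]; simp
end

section
/- Let I ⊆ m^2 be a homogeneous radical ideal in a polynomial ring over an algebraically closed field. Then the r-th secant ideal I^{{r}} is contained in m^{r+1}. -/
open MvPolynomial

/-- The `(r+1)`-st secant ideal: `secantIdeal I r` is the `(r+1)`-fold join of `I`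
with itself, so that `secantIdeal I 0 = I`. -/
noncomputable def secantIdeal {K : Type*} [Field K] {n : ℕ}
    (I : Ideal (MvPolynomial (Fin n) K)) : ℕ → Ideal (MvPolynomial (Fin n) K)
  | 0 => I
  | r + 1 => joinIdeal I (secantIdeal I r)

/-- A homogeneous ideal: one containing all homogeneous components of its elements. -/
def IsHomogeneousIdeal {K : Type*} [Field K] {n : ℕ}
    (I : Ideal (MvPolynomial (Fin n) K)) : Prop :=
  ∀ f ∈ I, ∀ d : ℕ, homogeneousComponent d f ∈ I


lemma join_eval {K : Type*} [Field K] {n : ℕ} (I J : Ideal (MvPolynomial (Fin n) K))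
    (a b : Fin n → K) (ha : ∀ p ∈ I, eval a p = 0) (hb : ∀ p ∈ J, eval b p = 0) :
    ∀ p ∈ joinIdeal I J, eval (a + b) p = 0 := by
  intro p hp
  let φ : MvPolynomial (Fin 3 × Fin n) K →+* K :=
    eval (fun q : Fin 3 × Fin n => (![a + b, a, b] : Fin 3 → Fin n → K) q.1 q.2)
  have hle : (Ideal.map (rename (fun i : Fin n => ((1 : Fin 3), i)) :
        MvPolynomial (Fin n) K →ₐ[K] MvPolynomial (Fin 3 × Fin n) K).toRingHom I ⊔
     Ideal.map (rename (fun i : Fin n => ((2 : Fin 3), i)) :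
        MvPolynomial (Fin n) K →ₐ[K] MvPolynomial (Fin 3 × Fin n) K).toRingHom J ⊔
     Ideal.span {p | ∃ i : Fin n,
       p = X ((0 : Fin 3), i) - X ((1 : Fin 3), i) - X ((2 : Fin 3), i)}) ≤ RingHom.ker φ := by
    refine sup_le (sup_le ?_ ?_) ?_
    · rw [Ideal.map_le_iff_le_comap]
      intro q hq
      have := ha q hq
      simp only [Ideal.mem_comap, RingHom.mem_ker, φ]
      simp [eval_rename]
      exact this
    · rw [Ideal.map_le_iff_le_comap]
      intro q hq
      have := hb q hq
      simp only [Ideal.mem_comap, RingHom.mem_ker, φ]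
      simp [eval_rename]
      exact this
    · rw [Ideal.span_le]
      rintro q ⟨i, rfl⟩
      simp [φ]
  have h := hle (Ideal.mem_comap.1 hp)
  simp only [RingHom.mem_ker, φ] at h
  simp [eval_rename] at h
  exact h

lemma secant_eval {K : Type*} [Field K] {n : ℕ} (I : Ideal (MvPolynomial (Fin n) K))
    {ι : Type*} (v : ι → Fin n → K) (h0 : ∀ p ∈ I, eval 0 p = 0)
    (hv : ∀ i, ∀ p ∈ I, eval (v i) p = 0) (r : ℕ) :
    ∀ S : Finset ι, S.card ≤ r + 1 → ∀ p ∈ secantIdeal I r, eval (∑ i ∈ S, v i) p = 0 := by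
  classical
  induction r with
  | zero =>
    intro S hS p hp
    rcases Finset.eq_empty_or_nonempty S with rfl | hne
    · simpa using h0 p hp
    · obtain ⟨i, rfl⟩ := Finset.card_eq_one.1 (le_antisymm hS hne.card_pos)
      simpa using hv i p hp
  | succ r ih =>
    intro S hS p hp
    rcases Finset.eq_empty_or_nonempty S with rfl | ⟨i, hi⟩
    · have := join_eval I (secantIdeal I r) 0 0 h0 (by simpa using ih ∅ (by simp)) p hp
      simpa using this
    · rw [← Finset.add_sum_erase S v hi]
      refine join_eval I (secantIdeal I r) _ _ (hv i) (ih _ ?_) p hp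
      rw [Finset.card_erase_of_mem hi]; omega

lemma coeff_kill {K : Type*} [Field K] {ι : Type*} [DecidableEq ι] (s : ι →₀ ℕ)
    (g : MvPolynomial ι K) :
    coeff s (aeval (fun i => if i ∈ s.support then (X i : MvPolynomial ι K) else 0) g)
      = coeff s g := by
  induction g using MvPolynomial.induction_on' with
  | add p q hp hq => simp only [map_add, coeff_add, hp, hq]
  | monomial u c =>
    rw [aeval_monomial]
    by_cases h : u.support ⊆ s.support
    · congr 1
      rw [monomial_eq]
      congr 1
      refine Finsupp.prod_congr fun i hi => ?_
      rw [if_pos (h hi)]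
    · obtain ⟨i, hi, hi'⟩ := Finset.not_subset.1 h
      have : (u.prod fun i k => (if i ∈ s.support then (X i : MvPolynomial ι K) else 0) ^ k) = 0 := by
        refine Finset.prod_eq_zero hi ?_
        simp only [if_neg hi']
        rw [zero_pow (Finsupp.mem_support_iff.1 hi)]
      rw [this, mul_zero, coeff_zero, coeff_monomial, if_neg]
      rintro rfl; exact h subset_rfl

lemma mem_pow_of_eval {K : Type*} [Field K] [Infinite K] {ι : Type*} [Fintype ι] [DecidableEq ι]
    (k : ℕ)
    (g : MvPolynomial ι K)
    (hg : ∀ (S : Finset ι) (t : ι → K), S.card ≤ k → eval (fun i => if i ∈ S then t i else 0) g = 0) :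
    g ∈ idealOfVars ι K ^ (k + 1) := by
  rw [mem_pow_idealOfVars_iff']
  intro s hs
  rw [← coeff_kill]
  have : aeval (fun i => if i ∈ s.support then (X i : MvPolynomial ι K) else 0) g = 0 := by
    apply MvPolynomial.funext
    intro x
    rw [map_zero, ← hg s.support x]
    · rw [← coe_aeval_eq_eval, ← coe_aeval_eq_eval]
      change aeval x (aeval _ g) = aeval _ g
      rw [← AlgHom.comp_apply, comp_aeval]
      congr 2
      ext i
      split_ifs <;> simp
    · have : s.support.card ≤ s.degree := by
        rw [Finsupp.degree, Finset.card_eq_sum_ones]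
        exact Finset.sum_le_sum fun i hi => Nat.one_le_iff_ne_zero.2 (Finsupp.mem_support_iff.1 hi)
      omega
  rw [this, coeff_zero]

lemma span_zero {K : Type*} [Field K] [IsAlgClosed K] {n : ℕ}
    (I : Ideal (MvPolynomial (Fin n) K)) 
    (hrad : I.IsRadical) (hm2 : I ≤ irrelevant K n ^ 2) :
    Submodule.span K (zeroLocus K I) = ⊤ := by
  by_contra hne
  obtain ⟨f, hf, hf'⟩ := Submodule.exists_dual_map_eq_bot_of_lt_top (lt_top_iff_ne_top.2 hne)
    inferInstance
  apply hf
  let ℓ : MvPolynomial (Fin n) K := ∑ i, C (f (Pi.single i 1)) * X i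
  have hev : ∀ x, aeval x ℓ = f x := by
    intro x
    conv_rhs => rw [pi_eq_sum_univ' x]
    simp [ℓ, mul_comm]
  have hℓ : ℓ ∈ I := by
    rw [← hrad.radical, ← vanishingIdeal_zeroLocus_eq_radical (K := K), mem_vanishingIdeal_iff]
    intro x hx
    rw [hev]
    have : f x ∈ Submodule.map f (Submodule.span K (zeroLocus K I)) :=
      Submodule.mem_map_of_mem (Submodule.subset_span hx)
    rwa [hf', Submodule.mem_bot] at this
  have h2 := (mem_pow_idealOfVars_iff' 2 ℓ).1 (hm2 hℓ)
  refine LinearMap.pi_ext' fun i => LinearMap.ext_ring ?_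
  have := h2 (Finsupp.single i 1) (by simp)
  simpa [ℓ, coeff_sum, coeff_C_mul, coeff_X, Finsupp.single_left_inj] using this

lemma cone {K : Type*} [Field K] {n : ℕ}
    (I : Ideal (MvPolynomial (Fin n) K)) (hhom : IsHomogeneousIdeal I) (v : Fin n → K)
    (hv : ∀ p ∈ I, eval v p = 0) (t : K) : ∀ p ∈ I, eval (t • v) p = 0 := by
  intro p hp
  rw [← sum_homogeneousComponent p, map_sum]
  refine Finset.sum_eq_zero fun d _ => ?_
  have : eval (t • v) (homogeneousComponent d p) = t ^ d * eval v (homogeneousComponent d p) := by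
    rw [eval_eq, eval_eq, Finset.mul_sum]
    refine Finset.sum_congr rfl fun u hu => ?_
    have hd := homogeneousComponent_isHomogeneous d p (mem_support_iff.1 hu)
    rw [Finsupp.weight_apply, Finsupp.sum] at hd
    simp only [Pi.smul_apply, smul_eq_mul, mul_pow, Finset.prod_mul_distrib,
      Finset.prod_pow_eq_pow_sum]
    simp at hd
    rw [hd]; ring
  rw [this, hv _ (hhom p hp d), mul_zero]

/-- if `I` is a homogeneous radical ideal contained in `m^2`,
then the `r`-th secant ideal is contained in `m^(r+1)` (here `secantIdeal I r`
is the `(r+1)`-st secant ideal). -/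
theorem secant_le_pow_irrelevant {K : Type*} [Field K] [IsAlgClosed K] {n : ℕ}
    (I : Ideal (MvPolynomial (Fin n) K)) (hhom : IsHomogeneousIdeal I)
    (hrad : I.IsRadical) (hm2 : I ≤ irrelevant K n ^ 2) (r : ℕ) :
    secantIdeal I r ≤ irrelevant K n ^ (r + 2) := by
  classical
  have h0 : ∀ p ∈ I, eval 0 p = 0 := by
    intro p hp
    have := (mem_pow_idealOfVars_iff' 2 p).1 (hm2 hp) 0 (by simp)
    rw [eval_zero]
    exact this
  have hsp := span_zero I hrad hm2
  let b := Module.Basis.ofSpan hsp.ge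
  have hb : ∀ i, ∀ p ∈ I, eval (b i) p = 0 := by
    intro i p hp
    have := Module.Basis.ofSpan_subset hsp.ge ⟨i, rfl⟩ p hp
    rw [← coe_aeval_eq_eval]
    exact this
  clear_value b
  revert b
  generalize ((linearIndepOn_empty K id).extend (Set.empty_subset (zeroLocus K I)) :
    Set (Fin n → K)) = B
  intro b hb
  haveI : Fintype B := FiniteDimensional.fintypeBasisIndex b
  intro f hf
  haveI : Infinite K := IsAlgClosed.instInfinite
  let g : MvPolynomial B K := aeval (fun j => ∑ i, C (b i j) * X i) f
  have hg : ∀ t : B → K, eval t g = eval (∑ i, t i • b i) f := by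
    intro t
    simp only [g]
    rw [← coe_aeval_eq_eval, ← coe_aeval_eq_eval]
    change aeval t (aeval _ f) = aeval _ f
    rw [← AlgHom.comp_apply, comp_aeval]
    congr 2
    ext j
    simp [mul_comm]
  have hmem : g ∈ idealOfVars B K ^ (r + 1 + 1) := by
    apply mem_pow_of_eval
    intro S t hS
    rw [hg]
    have := secant_eval I (fun i => t i • b i) h0 (fun i => cone I hhom _ (hb i) _) r S hS f hf
    simpa [ite_smul, Finset.sum_ite_mem] using this
  let ψ : MvPolynomial B K →ₐ[K] MvPolynomial (Fin n) K :=
    aeval (fun i => ∑ j, C (b.repr (Pi.single j 1) i) * X j)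
  have hf2 : f = ψ g := by
    apply MvPolynomial.funext
    intro x
    have h1 : eval x (ψ g) = eval (fun i => b.repr x i) g := by
      simp only [ψ]
      rw [← coe_aeval_eq_eval, ← coe_aeval_eq_eval]
      change aeval x (aeval _ g) = aeval _ g
      rw [← AlgHom.comp_apply, comp_aeval]
      congr 2
      ext i
      conv_rhs => rw [pi_eq_sum_univ' x]
      simp [mul_comm]
    rw [h1, hg, b.sum_repr]
  rw [hf2]
  have hmap : (idealOfVars B K).map ψ ≤ irrelevant K n := by
    rw [idealOfVars, Ideal.map_span, Ideal.span_le]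
    rintro _ ⟨_, ⟨i, rfl⟩, rfl⟩
    simp only [ψ, aeval_X, SetLike.mem_coe]
    exact Ideal.sum_mem _ fun j _ => Ideal.mul_mem_left _ _ (Ideal.subset_span ⟨j, rfl⟩)
  have := Ideal.mem_map_of_mem ψ hmem
  rw [Ideal.map_pow] at this
  exact Ideal.pow_right_mono hmap _ this
end

section
/- Let G be a finite simple graph. Then G is perfect if and only if for all r ≥ 1, the r-th symbolic power of the edge ideal I(G) is generated by the monomials ∏_{i=1}^l m_{V_i} where each V_i is a clique of G of cardinality ≥ 2 and ∑_{i=1}^l (|V_i| − 1) = r. -/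
open MvPolynomial

/-- The complement of the union of the minimal primes of `I`, as a submonoid. -/
def symbCompl {R : Type*} [CommRing R] (I : Ideal R) : Submonoid R where
  carrier := {s | ∀ p ∈ I.minimalPrimes, s ∉ p}
  one_mem' := by
    intro p hp h1
    exact hp.1.1.ne_top ((Ideal.eq_top_iff_one p).mpr h1)
  mul_mem' := by
    intro a b ha hb p hp hab
    rcases hp.1.1.mem_or_mem hab with h | h
    · exact ha p hp h
    · exact hb p hp h

/-- The `r`-th symbolic power of `I`. -/
noncomputable def symbolicPower {R : Type*} [CommRing R] (I : Ideal R) (r : ℕ) : Ideal R :=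
  Ideal.comap (algebraMap R (Localization (symbCompl I)))
    (Ideal.map (algebraMap R (Localization (symbCompl I))) (I ^ r))

/-- The edge ideal of a simple graph. -/
noncomputable def graphEdgeIdeal (K : Type*) [Field K] {n : ℕ} (G : SimpleGraph (Fin n)) :
    Ideal (MvPolynomial (Fin n) K) :=
  Ideal.span {m | ∃ i j : Fin n, G.Adj i j ∧ m = X i * X j}

/-- The clique number of a graph. -/
noncomputable def cliqueNum {V : Type*} (G : SimpleGraph V) : ℕ :=
  sSup {k | ∃ t : Finset V, G.IsNClique k t}

/-- A graph is perfect if every induced subgraph has clique number equal to its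
chromatic number. -/
def IsPerfect {V : Type*} (G : SimpleGraph V) : Prop :=
  ∀ s : Set V, (cliqueNum (G.induce s) : ℕ∞) = (G.induce s).chromaticNumber


section Comb
set_option linter.unusedSectionVars false
variable {V : Type*} [Fintype V] [DecidableEq V]

def CCov (H : SimpleGraph V) (k : ℕ) (a : V → ℕ) : Prop :=
  ∃ M : Multiset (Finset V), M.card = k ∧ (∀ T ∈ M, H.IsClique (T : Set V)) ∧
    ∀ v, M.countP (fun T => v ∈ T) = a v

def UnP (H : SimpleGraph V) : Prop :=
  ∀ (U : Finset V) (k : ℕ), (∀ T : Finset V, T ⊆ U → Hᶜ.IsClique (T : Set V) → T.card ≤ k) →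
    CCov H k (fun v => if v ∈ U then 1 else 0)

def WtP (H : SimpleGraph V) : Prop :=
  ∀ (a : V → ℕ) (k : ℕ), (∀ T : Finset V, Hᶜ.IsClique (T : Set V) → ∑ v ∈ T, a v ≤ k) →
    CCov H k a

lemma inter_card_le {H : SimpleGraph V} {K T : Finset V} (hK : H.IsClique (K : Set V))
    (hT : Hᶜ.IsClique (T : Set V)) : (T ∩ K).card ≤ 1 := by
  rw [Finset.card_le_one]
  intro a ha b hb
  simp only [Finset.mem_inter] at ha hb
  by_contra hne
  have h1 := hK ha.2 hb.2 hne
  have h2 := hT ha.1 hb.1 hne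
  rw [SimpleGraph.compl_adj] at h2
  exact h2.2 h1

lemma sum_countP (M : Multiset (Finset V)) (K : Finset V) :
    ∑ v ∈ K, M.countP (fun T => v ∈ T) = (M.map (fun T => (T ∩ K).card)).sum := by
  induction M using Multiset.induction_on with
  | empty => simp
  | cons T M ih =>
    simp only [Multiset.countP_cons, Multiset.map_cons, Multiset.sum_cons, Finset.sum_add_distrib, ih]
    rw [add_comm]
    congr 1
    simp [Finset.inter_comm]

lemma sum_map_le (M : Multiset (Finset V)) (f : Finset V → ℕ) (c : ℕ) (h : ∀ T ∈ M, f T ≤ c) :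
    (M.map f).sum ≤ M.card * c := by
  have := Multiset.sum_le_card_nsmul (M.map f) c (by simpa using h)
  simpa using this

lemma CCov.cons {H : SimpleGraph V} {k : ℕ} {a b : V → ℕ} (h : CCov H k a) (K : Finset V)
    (hK : H.IsClique (K : Set V)) (hb : ∀ v, b v = a v + if v ∈ K then 1 else 0) :
    CCov H (k + 1) b := by
  obtain ⟨M, h1, h2, h3⟩ := h
  refine ⟨K ::ₘ M, by simp [h1], ?_, ?_⟩
  · intro T hT
    rcases Multiset.mem_cons.1 hT with rfl | hT
    · exact hK
    · exact h2 T hT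
  · intro v
    rw [Multiset.countP_cons, h3, hb]

lemma step1 {H : SimpleGraph V} (hU : UnP H) : WtP H := by
  suffices h : ∀ (N : ℕ) (a : V → ℕ) (k : ℕ), ∑ v, a v = N →
      (∀ T : Finset V, Hᶜ.IsClique (T : Set V) → ∑ v ∈ T, a v ≤ k) → CCov H k a from
    fun a k hk => h _ a k rfl hk
  intro N
  induction N using Nat.strong_induction_on with
  | _ N ih =>
  intro a k hN hk
  by_cases hle : ∀ v, a v ≤ 1
  · have := hU (Finset.univ.filter (fun v => a v = 1)) k (by
      intro T hT hTc
      refine le_trans ?_ (hk T hTc)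
      rw [Finset.card_eq_sum_ones]
      apply Finset.sum_le_sum
      intro v hv
      have := hT hv
      simp at this
      omega)
    convert this using 2 with v
    have := hle v
    simp
    split_ifs <;> omega
  · push Not at hle
    obtain ⟨v, hv⟩ := hle
    have hvT : ({v} : Finset V).sum a ≤ k := hk {v} (by simp)
    simp at hvT
    let a' : V → ℕ := fun w => if w = v then a w - 1 else a w
    have ha'le : ∀ w, a' w ≤ a w := by intro w; simp only [a']; split_ifs <;> omega
    have ha'lt : ∑ w, a' w < N := by
      rw [← hN]
      apply Finset.sum_lt_sum (fun w _ => ha'le w)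
      exact ⟨v, Finset.mem_univ _, by simp only [a', if_true]; omega⟩
    obtain ⟨M, h1, h2, h3⟩ := ih _ ha'lt a' k rfl
      (fun T hT => (Finset.sum_le_sum (fun w _ => ha'le w)).trans (hk T hT))
    have hpos : 0 < M.countP (fun T => v ∈ T) := by
      rw [h3]; simp only [a', if_true]; omega
    obtain ⟨S, hSM, hvS⟩ := Multiset.countP_pos.1 hpos
    have hSa' : ∀ w ∈ S, 1 ≤ a' w := by
      intro w hw
      rw [← h3]
      exact Multiset.countP_pos.2 ⟨S, hSM, hw⟩
    let a'' : V → ℕ := fun w => a w - if w ∈ S then 1 else 0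
    have hadd : ∀ w, a w = a'' w + if w ∈ S then 1 else 0 := by
      intro w
      simp only [a'']
      have := hSa' w
      have := ha'le w
      split_ifs with h
      · have := hSa' w h; omega
      · omega
    have ha''lt : ∑ w, a'' w < N := by
      rw [← hN]
      apply Finset.sum_lt_sum
      · intro w _
        rw [hadd w]; omega
      · refine ⟨v, Finset.mem_univ _, ?_⟩
        rw [hadd v, if_pos hvS]; omega
    have hk1 : k = (k - 1) + 1 := by omega
    rw [hk1]
    refine CCov.cons (ih _ ha''lt a'' (k-1) rfl ?_) S (h2 S hSM) hadd
    intro T hT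
    have e1 : ∑ w ∈ T, a w = ∑ w ∈ T, a'' w + (T ∩ S).card := by
      rw [Finset.sum_congr rfl (fun w _ => hadd w), Finset.sum_add_distrib]
      simp
    have e2 := hk T hT
    by_contra hcon
    have hTS : (T ∩ S).card = 0 := by omega
    have hk' : ∑ w ∈ T, a w = k := by omega
    have hvT' : v ∉ T := by
      intro h
      rw [Finset.card_eq_zero] at hTS
      have : v ∈ T ∩ S := Finset.mem_inter.2 ⟨h, hvS⟩
      rw [hTS] at this
      simp at this
    have e3 : ∑ w ∈ T, a' w = k := by
      rw [← hk']
      apply Finset.sum_congr rfl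
      intro w hw
      have : w ≠ v := by rintro rfl; exact hvT' hw
      simp [a', this]
    rw [← Finset.sum_congr rfl (fun w _ => h3 w), sum_countP, ← Multiset.cons_erase hSM,
      Multiset.map_cons, Multiset.sum_cons, Finset.inter_comm, hTS] at e3
    have e4 := sum_map_le (M.erase S) (fun S => (S ∩ T).card) 1 (by
      intro S' hS'
      rw [Finset.inter_comm]
      exact inter_card_le (h2 S' (Multiset.mem_of_mem_erase hS')) hT)
    rw [Multiset.card_erase_of_mem hSM, h1] at e4
    simp only [Nat.pred_eq_sub_one] at e4
    omega

lemma step2 {H : SimpleGraph V} (hW : WtP H) : UnP Hᶜ := by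
  classical
  intro U k
  rw [compl_compl]
  induction k generalizing U with
  | zero =>
    intro h
    have : U = ∅ := by
      rw [Finset.eq_empty_iff_forall_notMem]
      intro v hv
      have := h {v} (by simpa using hv) (by simp)
      simp at this
    subst this
    exact ⟨0, by simp, by simp, by simp⟩
  | succ k ih =>
    intro h
    have key : ∃ K : Finset V, Hᶜ.IsClique (K : Set V) ∧
        ∀ T : Finset V, T ⊆ U \ K → H.IsClique (T : Set V) → T.card ≤ k := by
      by_contra hcon
      push Not at hcon
      choose! S hS1 hS2 hS3 using hcon
      let C : Finset (Finset V) := Finset.univ.filter (fun K => Hᶜ.IsClique (K : Set V))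
      have hC : ∀ K, K ∈ C ↔ Hᶜ.IsClique (K : Set V) := by simp [C]
      have hCpos : 0 < C.card := Finset.card_pos.2 ⟨∅, by rw [hC]; simp⟩
      let a : V → ℕ := fun v => (C.val.map S).countP (fun T => v ∈ T)
      obtain ⟨M, h1, h2, h3⟩ := hW a (C.card - 1) (by
        intro T hT
        simp only [a]
        rw [sum_countP]
        have hTC : T ∈ C.val := (hC T).2 hT
        rw [← Multiset.cons_erase hTC, Multiset.map_map, Multiset.map_cons, Multiset.sum_cons]
        have z : (S T ∩ T).card = 0 := by
          rw [Finset.card_eq_zero, Finset.eq_empty_iff_forall_notMem]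
          intro v hv
          rw [Finset.mem_inter] at hv
          have := hS1 T hT hv.1
          rw [Finset.mem_sdiff] at this
          exact this.2 hv.2
        have := sum_map_le (C.val.erase T) (fun K => (S K ∩ T).card) 1 (by
          intro K hK
          have hK' : Hᶜ.IsClique (K : Set V) := (hC K).1 (Multiset.mem_of_mem_erase hK)
          rw [Finset.inter_comm]
          exact inter_card_le (hS2 K hK') hT)
        rw [Multiset.card_erase_of_mem hTC] at this
        simp only [Nat.pred_eq_sub_one, mul_one] at this
        simp only [Function.comp_apply, z, zero_add]
        exact this)
      have t1 : ∑ v, a v = (M.map (fun T => (T ∩ Finset.univ).card)).sum := by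
        rw [← sum_countP]
        exact Finset.sum_congr rfl (fun v _ => (h3 v).symm)
      have t2 : ∑ v, a v = ((C.val.map S).map (fun T => (T ∩ Finset.univ).card)).sum := by
        rw [← sum_countP]
      have t3 : (M.map (fun T => (T ∩ Finset.univ).card)).sum ≤ M.card * (k+1) := by
        apply sum_map_le
        intro T hT
        rw [Finset.inter_univ]
        refine h T ?_ (h2 T hT)
        intro v hv
        have : 0 < a v := by
          rw [← h3]
          exact Multiset.countP_pos.2 ⟨T, hT, hv⟩
        obtain ⟨T', hT', hv'⟩ := Multiset.countP_pos.1 this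
        obtain ⟨K, hK, rfl⟩ := Multiset.mem_map.1 hT'
        exact (Finset.mem_sdiff.1 (hS1 K ((hC K).1 hK) hv')).1
      have t4 : C.card * (k+1) ≤ ((C.val.map S).map (fun T => (T ∩ Finset.univ).card)).sum := by
        rw [Multiset.map_map]
        change C.card * (k+1) ≤ ∑ K ∈ C, _
        rw [← smul_eq_mul]
        apply Finset.card_nsmul_le_sum
        intro K hK
        have := hS3 K ((hC K).1 hK)
        simp only [Function.comp_apply, Finset.inter_univ]
        omega
      rw [h1] at t3
      have t5 : C.card * (k+1) ≤ (C.card - 1) * (k+1) := by omega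
      have := Nat.le_of_mul_le_mul_right t5 (by omega)
      omega
    obtain ⟨K, hK, hK2⟩ := key
    refine CCov.cons (ih (U \ K) hK2) (K ∩ U) (hK.subset (by simp)) ?_
    intro v
    by_cases h1 : v ∈ U <;> by_cases h2 : v ∈ K <;> simp [h1, h2]

lemma perfect_iff (G : SimpleGraph V) : IsPerfect G ↔ UnP Gᶜ := by
  classical
  constructor
  · intro h U k hk
    rw [compl_compl] at hk
    have h1 := h (U : Set V)
    have h2 : cliqueNum (G.induce (U : Set V)) ≤ k := by
      apply csSup_le'
      rintro m ⟨t, ht⟩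
      rw [← ht.card_eq, ← Finset.card_map (Function.Embedding.subtype _)]
      apply hk
      · intro v hv
        simp at hv
        exact hv.1
      · have := ht.isClique
        intro x hx y hy hxy
        simp at hx hy
        obtain ⟨hxU, hx⟩ := hx
        obtain ⟨hyU, hy⟩ := hy
        exact this hx hy (by simpa using hxy)
    have h3 : (G.induce (U : Set V)).Colorable k := by
      rw [← SimpleGraph.chromaticNumber_le_iff_colorable, ← h1]
      exact_mod_cast h2
    obtain ⟨c⟩ := h3
    refine ⟨(Finset.univ : Finset (Fin k)).val.map
      (fun i => Finset.univ.filter (fun v => ∃ hv : v ∈ (U : Set V), c ⟨v, hv⟩ = i)), by simp, ?_, ?_⟩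
    · intro T hT
      obtain ⟨i, -, rfl⟩ := Multiset.mem_map.1 hT
      intro x hx y hy hxy
      simp at hx hy
      obtain ⟨hxU, hx⟩ := hx
      obtain ⟨hyU, hy⟩ := hy
      rw [SimpleGraph.compl_adj]
      refine ⟨hxy, fun hadj => ?_⟩
      have : (G.induce (U : Set V)).Adj ⟨x, hxU⟩ ⟨y, hyU⟩ := hadj
      exact c.valid this (hx.trans hy.symm)
    · intro v
      rw [Multiset.countP_map]
      change (Finset.univ.filter _).card = if v ∈ U then 1 else 0
      split_ifs with hv
      · rw [Finset.card_eq_one]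
        refine ⟨c ⟨v, hv⟩, ?_⟩
        ext i
        simp [hv, eq_comm]
      · simp [hv]
  · intro h s
    have hb : BddAbove {k | ∃ t : Finset s, (G.induce s).IsNClique k t} := by
      refine ⟨Fintype.card s, ?_⟩
      rintro k ⟨t, ht⟩
      rw [← ht.card_eq]
      exact Finset.card_le_univ _
    apply le_antisymm
    · obtain ⟨t, ht⟩ : cliqueNum (G.induce s) ∈ {k | ∃ t : Finset s, (G.induce s).IsNClique k t} :=
        Nat.sSup_mem ⟨0, ∅, by simp⟩ hb
      rw [← ht.card_eq]
      exact ht.isClique.card_le_chromaticNumber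
    · rw [SimpleGraph.chromaticNumber_le_iff_colorable]
      obtain ⟨M, h1, h2, h3⟩ := h s.toFinset (cliqueNum (G.induce s)) (by
        intro T hT hTc
        rw [compl_compl] at hTc
        apply le_csSup hb
        refine ⟨T.subtype (· ∈ s), ?_, ?_⟩
        · intro x hx y hy hxy
          simp at hx hy
          exact hTc hx hy (by simpa [Subtype.ext_iff] using hxy)
        · rw [Finset.card_subtype, Finset.filter_true_of_mem]
          intro x hx
          simpa using hT hx)
      obtain ⟨l, rfl⟩ := Quot.exists_rep M
      have hl : l.length = cliqueNum (G.induce s) := h1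
      have ex : ∀ v : s, ∃ i : Fin l.length, v.1 ∈ l.get i := by
        intro v
        have : 0 < Multiset.countP (fun T => v.1 ∈ T) (Quot.mk _ l) := by
          rw [h3]; simp
        obtain ⟨T, hT, hv⟩ := Multiset.countP_pos.1 this
        have hT : T ∈ l := hT
        obtain ⟨i, hi⟩ := List.get_of_mem hT
        exact ⟨i, by rw [hi]; exact hv⟩
      choose c hc using ex
      rw [← hl]
      refine ⟨SimpleGraph.Coloring.mk c ?_⟩
      intro x y hxy hcxy
      have hcl := h2 (l.get (c x)) (List.get_mem l (c x))
      have hy := hc y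
      rw [← hcxy] at hy
      have := hcl (hc x) hy (by simpa [Subtype.ext_iff] using hxy.ne)
      rw [SimpleGraph.compl_adj] at this
      exact this.2 hxy
end Comb

section Alg
variable {K : Type*} [Field K] {n : ℕ}

noncomputable def phiC (K : Type*) [Field K] {n : ℕ} (C : Finset (Fin n)) :
    MvPolynomial (Fin n) K →ₐ[K] Polynomial (MvPolynomial (Fin n) K) :=
  aeval (fun i => if i ∈ C then Polynomial.X * Polynomial.C (X i) else Polynomial.C (X i))

lemma phiC_monomial (C : Finset (Fin n)) (a : Fin n →₀ ℕ) (c : K) :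
    phiC K C (monomial a c) = Polynomial.X ^ (∑ i ∈ C, a i) * Polynomial.C (monomial a c) := by
  have h : ∀ i, (if i ∈ C then Polynomial.X * Polynomial.C (X i) else Polynomial.C (X i) :
      Polynomial (MvPolynomial (Fin n) K)) =
      (if i ∈ C then Polynomial.X else 1) * Polynomial.C (X i) := by
    intro i; split_ifs <;> simp
  rw [phiC, aeval_monomial, Finsupp.prod_fintype _ _ (by simp), monomial_eq,
    Finsupp.prod_fintype _ _ (by simp)]
  simp only [h, mul_pow, Finset.prod_mul_distrib, map_mul, map_prod, map_pow]
  have h2 : (∏ i, (if i ∈ C then Polynomial.X else 1 :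
      Polynomial (MvPolynomial (Fin n) K)) ^ a i) = Polynomial.X ^ (∑ i ∈ C, a i) := by
    rw [← Finset.prod_pow_eq_pow_sum]
    simp only [ite_pow, one_pow]
    rw [Finset.prod_ite_mem]
    simp
  rw [h2]
  have h3 : algebraMap K (Polynomial (MvPolynomial (Fin n) K)) c = Polynomial.C (MvPolynomial.C c) := rfl
  rw [h3]
  ring

lemma phiC_coeff (C : Finset (Fin n)) (f : MvPolynomial (Fin n) K) (a : Fin n →₀ ℕ) (d : ℕ) :
    MvPolynomial.coeff a (Polynomial.coeff (phiC K C f) d) =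
      if ∑ i ∈ C, a i = d then MvPolynomial.coeff a f else 0 := by
  induction f using MvPolynomial.induction_on' with
  | monomial b c =>
    rw [phiC_monomial, mul_comm, Polynomial.coeff_C_mul_X_pow]
    by_cases hab : b = a
    · subst hab
      by_cases hd : d = ∑ i ∈ C, b i
      · simp [hd]
      · rw [if_neg hd, if_neg (Ne.symm hd)]; simp
    · split_ifs <;> simp [MvPolynomial.coeff_monomial, hab]
  | add p q hp hq =>
    rw [map_add, Polynomial.coeff_add, MvPolynomial.coeff_add, hp, hq, MvPolynomial.coeff_add]
    split_ifs <;> simp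

lemma phiC_dvd (C : Finset (Fin n)) (f : MvPolynomial (Fin n) K) (r : ℕ) :
    Polynomial.X ^ r ∣ phiC K C f ↔ ∀ a ∈ f.support, r ≤ ∑ i ∈ C, a i := by
  rw [Polynomial.X_pow_dvd_iff]
  constructor
  · intro h a ha
    by_contra hlt
    have h1 := phiC_coeff C f a (∑ i ∈ C, a i)
    rw [h _ (by omega), if_pos rfl] at h1
    exact (MvPolynomial.mem_support_iff.1 ha) (by simpa using h1.symm)
  · intro h d hd
    ext a
    rw [phiC_coeff]
    split_ifs with hs
    · rw [MvPolynomial.coeff_zero]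
      by_contra hne
      have := h a (MvPolynomial.mem_support_iff.2 hne)
      omega
    · simp

/-- The prime of variables in C. -/
noncomputable def PC (K : Type*) [Field K] {n : ℕ} (C : Finset (Fin n)) :
    Ideal (MvPolynomial (Fin n) K) :=
  (Ideal.span {(Polynomial.X : Polynomial (MvPolynomial (Fin n) K))}).comap (phiC K C)

lemma mem_PC (C : Finset (Fin n)) (f : MvPolynomial (Fin n) K) :
    f ∈ PC K C ↔ Polynomial.X ∣ phiC K C f := by
  rw [PC, Ideal.mem_comap, Ideal.mem_span_singleton]

lemma PC_prime (C : Finset (Fin n)) : (PC K C).IsPrime := by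
  have : (Ideal.span {(Polynomial.X : Polynomial (MvPolynomial (Fin n) K))}).IsPrime :=
    (Ideal.span_singleton_prime Polynomial.X_ne_zero).2 Polynomial.prime_X
  unfold PC
  infer_instance

lemma mem_PC' (C : Finset (Fin n)) (f : MvPolynomial (Fin n) K) :
    f ∈ PC K C ↔ ∀ a ∈ f.support, 1 ≤ ∑ i ∈ C, a i := by
  rw [mem_PC, ← phiC_dvd, pow_one]

lemma X_mem_PC (C : Finset (Fin n)) (i : Fin n) :
    (X i : MvPolynomial (Fin n) K) ∈ PC K C ↔ i ∈ C := by
  rw [mem_PC', support_X]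
  by_cases h : i ∈ C <;> simp [Finsupp.single_apply, h]

lemma PC_le (C : Finset (Fin n)) (Q : Ideal (MvPolynomial (Fin n) K))
    (h : ∀ i ∈ C, (X i : MvPolynomial (Fin n) K) ∈ Q) : PC K C ≤ Q := by
  intro f hf
  rw [mem_PC'] at hf
  rw [f.as_sum]
  refine Ideal.sum_mem _ (fun a ha => ?_)
  have h1 := hf a ha
  obtain ⟨i, hi, hai⟩ : ∃ i ∈ C, a i ≠ 0 := by
    by_contra hcon
    push Not at hcon
    rw [Finset.sum_eq_zero hcon] at h1
    omega
  have : (X i : MvPolynomial (Fin n) K) ∣ monomial a (coeff a f) := by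
    rw [X_dvd_monomial]
    exact Or.inr hai
  exact Ideal.mem_of_dvd _ this (h i hi)

lemma edge_le_PC (G : SimpleGraph (Fin n)) (S : Finset (Fin n)) (hS : Gᶜ.IsClique (S : Set (Fin n))) :
    graphEdgeIdeal K G ≤ PC K Sᶜ := by
  unfold graphEdgeIdeal
  rw [Ideal.span_le]
  rintro _ ⟨i, j, hij, rfl⟩
  by_cases hi : i ∈ S
  · by_cases hj : j ∈ S
    · have := hS hi hj hij.ne
      rw [SimpleGraph.compl_adj] at this
      exact absurd hij this.2
    · exact Ideal.mul_mem_left _ _ ((X_mem_PC _ _).2 (by simpa using hj))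
  · exact Ideal.mul_mem_right _ _ ((X_mem_PC _ _).2 (by simpa using hi))

lemma symb_mem_iff {R : Type*} [CommRing R] (I : Ideal R) (r : ℕ) (f : R) :
    f ∈ symbolicPower I r ↔ ∃ s ∈ symbCompl I, s * f ∈ I ^ r := by
  rw [symbolicPower, Ideal.mem_comap,
    IsLocalization.algebraMap_mem_map_algebraMap_iff (symbCompl I)]

lemma symb_imp_max (G : SimpleGraph (Fin n)) (r : ℕ) (f : MvPolynomial (Fin n) K)
    (hf : f ∈ symbolicPower (graphEdgeIdeal K G) r) (S : Finset (Fin n))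
    (hS : Gᶜ.IsClique (S : Set (Fin n))) (hmax : ∀ i, i ∉ S → ∃ j ∈ S, G.Adj i j)
    (a : Fin n →₀ ℕ) (ha : a ∈ f.support) : r ≤ ∑ i ∈ Sᶜ, a i := by
  have hmin : PC K Sᶜ ∈ (graphEdgeIdeal K G).minimalPrimes := by
    refine ⟨⟨PC_prime _, edge_le_PC G S hS⟩, ?_⟩
    rintro Q ⟨hQ, hIQ⟩ hle
    apply PC_le
    intro i hi
    obtain ⟨j, hj, hij⟩ := hmax i (by simpa using hi)
    have : (X i * X j : MvPolynomial (Fin n) K) ∈ Q :=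
      hIQ (Ideal.subset_span ⟨i, j, hij, rfl⟩)
    rcases hQ.mem_or_mem this with h | h
    · exact h
    · have := (X_mem_PC _ _).1 (hle h)
      simp [hj] at this
  obtain ⟨s, hs, hsf⟩ := (symb_mem_iff _ _ _).1 hf
  have hs' := hs _ hmin
  rw [mem_PC] at hs'
  refine (phiC_dvd _ _ _).1 ?_ a ha
  have h1 : phiC K Sᶜ (s * f) ∈ (Ideal.span {(Polynomial.X : Polynomial (MvPolynomial (Fin n) K))}) ^ r := by
    have h2 : s * f ∈ (PC K Sᶜ) ^ r := Ideal.pow_right_mono (edge_le_PC G S hS) r hsf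
    exact Ideal.mem_comap.1 (Ideal.le_comap_pow (phiC K Sᶜ) r h2)
  rw [Ideal.span_singleton_pow, Ideal.mem_span_singleton, map_mul] at h1
  exact Polynomial.prime_X.pow_dvd_of_dvd_mul_left r hs' h1

lemma symb_imp (G : SimpleGraph (Fin n)) (r : ℕ) (f : MvPolynomial (Fin n) K)
    (hf : f ∈ symbolicPower (graphEdgeIdeal K G) r) (a : Fin n →₀ ℕ) (ha : a ∈ f.support)
    (S : Finset (Fin n))
    (hS : Gᶜ.IsClique (S : Set (Fin n))) : r ≤ ∑ i ∈ Sᶜ, a i := by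
  obtain ⟨T, hST, hT⟩ := Finite.exists_le_maximal (p := fun T : Finset (Fin n) =>
    Gᶜ.IsClique (T : Set (Fin n))) hS
  refine (symb_imp_max G r f hf T hT.prop ?_ a ha).trans ?_
  · intro i hi
    by_contra hcon
    push Not at hcon
    have : Gᶜ.IsClique ((insert i T : Finset (Fin n)) : Set (Fin n)) := by
      rw [Finset.coe_insert]
      refine hT.prop.insert ?_
      intro j hj hij
      rw [SimpleGraph.compl_adj]
      exact ⟨hij, hcon j hj⟩
    exact hi (hT.le_of_ge this (Finset.subset_insert _ _) (Finset.mem_insert_self _ _))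
  · exact Finset.sum_le_sum_of_subset (Finset.compl_subset_compl.2 hST)

lemma symb_of_mono (G : SimpleGraph (Fin n)) (r : ℕ) (a : Fin n →₀ ℕ) (c : K)
    (h : ∀ S : Finset (Fin n), Gᶜ.IsClique (S : Set (Fin n)) → r ≤ ∑ i ∈ Sᶜ, a i) :
    monomial a c ∈ symbolicPower (graphEdgeIdeal K G) r := by
  classical
  set I := graphEdgeIdeal K G with hI
  rw [symb_mem_iff]
  let J : Ideal (MvPolynomial (Fin n) K) :=
    Submodule.comap (LinearMap.mulRight (MvPolynomial (Fin n) K) (monomial a c)) (I ^ r)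
  have hJ : ∀ s, s ∈ J ↔ s * monomial a c ∈ I ^ r := fun s => Iff.rfl
  by_contra hcon
  push Not at hcon
  have hfin : I.minimalPrimes.Finite := Ideal.finite_minimalPrimes_of_isNoetherianRing _ I
  have hsub : (J : Set (MvPolynomial (Fin n) K)) ⊆ ⋃ p ∈ (hfin.toFinset : Set _), ((id p : Ideal (MvPolynomial (Fin n) K)) : Set (MvPolynomial (Fin n) K)) := by
    intro s hs
    by_contra hns
    refine hcon s ?_ ((hJ s).1 hs)
    intro p hp hsp
    apply hns
    simp only [Set.mem_iUnion]
    exact ⟨p, by simpa using hp, hsp⟩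
  rw [Ideal.subset_union_prime ⊥ ⊥ (by
    intro p hp _ _
    have : p ∈ I.minimalPrimes := by simpa using hp
    exact this.1.1)] at hsub
  obtain ⟨Q, hQ, hJQ⟩ := hsub
  have hQ : Q ∈ I.minimalPrimes := by simpa using hQ
  have hQp : Q.IsPrime := hQ.1.1
  let S : Finset (Fin n) := Finset.univ.filter (fun i => (X i : MvPolynomial (Fin n) K) ∉ Q)
  have hSm : ∀ i, i ∈ S ↔ (X i : MvPolynomial (Fin n) K) ∉ Q := by simp [S]
  have hSc : Gᶜ.IsClique (S : Set (Fin n)) := by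
    intro i hi j hj hij
    rw [SimpleGraph.compl_adj]
    refine ⟨hij, fun hadj => ?_⟩
    have : (X i * X j : MvPolynomial (Fin n) K) ∈ Q :=
      hQ.1.2 (Ideal.subset_span ⟨i, j, hadj, rfl⟩)
    rcases hQp.mem_or_mem this with h | h
    · exact (hSm i).1 hi h
    · exact (hSm j).1 hj h
  have hmax : ∀ i, i ∉ S → ∃ j ∈ S, G.Adj i j := by
    intro i hi
    by_contra hno
    push Not at hno
    have hins : Gᶜ.IsClique ((insert i S : Finset (Fin n)) : Set (Fin n)) := by
      rw [Finset.coe_insert]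
      refine hSc.insert ?_
      intro j hj hij
      rw [SimpleGraph.compl_adj]
      exact ⟨hij, hno j hj⟩
    have hle : PC K (insert i S)ᶜ ≤ Q := by
      apply PC_le
      intro j hj
      by_contra hj'
      have := (hSm j).2 hj'
      simp [this] at hj
    have h2 := hQ.2 ⟨PC_prime _, edge_le_PC G _ hins⟩ hle
    have h3 : (X i : MvPolynomial (Fin n) K) ∈ Q := by
      by_contra h; exact hi ((hSm i).2 h)
    have := (X_mem_PC _ _).1 (h2 h3)
    simp at this
  let mS : MvPolynomial (Fin n) K := ∏ j ∈ S, X j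
  have hmS : mS ∉ Q := by
    intro hmem
    obtain ⟨j, hj, hjQ⟩ := (hQp.prod_mem_iff).1 hmem
    exact (hSm j).1 hj hjQ
  have hin : mS ^ (∑ i ∈ Sᶜ, a i) ∈ J := by
    rw [hJ]
    have h1 : ∏ i ∈ Sᶜ, (X i * mS) ^ a i ∈ I ^ (∑ i ∈ Sᶜ, a i) := by
      rw [← Finset.prod_pow_eq_pow_sum]
      apply Ideal.prod_mem_prod
      intro i hi
      apply Ideal.pow_mem_pow
      obtain ⟨j, hj, hij⟩ := hmax i (by simpa using hi)
      have hd : (X j : MvPolynomial (Fin n) K) ∣ mS := Finset.dvd_prod_of_mem _ hj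
      exact Ideal.mem_of_dvd _ (mul_dvd_mul_left _ hd) (Ideal.subset_span ⟨i, j, hij, rfl⟩)
    have h2 := Ideal.pow_le_pow_right (h S hSc) h1
    refine Ideal.mem_of_dvd _ ?_ h2
    simp only [mul_pow, Finset.prod_mul_distrib]
    rw [Finset.prod_pow_eq_pow_sum, mul_comm]
    apply mul_dvd_mul_left
    rw [monomial_eq, Finsupp.prod_fintype _ _ (by simp), ← Finset.prod_mul_prod_compl S]
    exact Dvd.intro_left (C c * ∏ i ∈ S, X i ^ a i) (by ring)
  exact hmS (hQp.mem_of_pow_mem _ (hJQ hin))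

lemma mem_symb_iff (G : SimpleGraph (Fin n)) (r : ℕ) (f : MvPolynomial (Fin n) K) :
    f ∈ symbolicPower (graphEdgeIdeal K G) r ↔ ∀ a ∈ f.support,
      ∀ S : Finset (Fin n), Gᶜ.IsClique (S : Set (Fin n)) → r ≤ ∑ i ∈ Sᶜ, a i := by
  constructor
  · intro hf a ha S hS
    exact symb_imp G r f hf a ha S hS
  · intro h
    rw [f.as_sum]
    exact Ideal.sum_mem _ (fun a ha => symb_of_mono G r a _ (h a ha))

def Good (G : SimpleGraph (Fin n)) (r : ℕ) (M : Multiset (Finset (Fin n))) : Prop :=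
  (∀ T ∈ M, G.IsClique (T : Set (Fin n)) ∧ 2 ≤ T.card) ∧ (M.map (fun T => T.card - 1)).sum = r

noncomputable def cnt (M : Multiset (Finset (Fin n))) : Fin n →₀ ℕ :=
  Finsupp.equivFunOnFinite.symm (fun v => M.countP (fun T => v ∈ T))

lemma cnt_apply (M : Multiset (Finset (Fin n))) (v : Fin n) :
    cnt M v = M.countP (fun T => v ∈ T) := rfl

lemma prod_eq_cnt (M : Multiset (Finset (Fin n))) :
    (M.map (fun T => ∏ j ∈ T, (X j : MvPolynomial (Fin n) K))).prod = monomial (cnt M) 1 := by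
  induction M using Multiset.induction_on with
  | empty =>
    have : cnt (0 : Multiset (Finset (Fin n))) = 0 := by ext v; simp [cnt_apply]
    simp [this]
  | cons T M ih =>
    have h : cnt (T ::ₘ M) = (∑ j ∈ T, Finsupp.single j 1) + cnt M := by
      ext v
      simp [cnt_apply, Multiset.countP_cons, Finsupp.single_apply, add_comm]
    rw [Multiset.map_cons, Multiset.prod_cons, ih, h]
    have e : monomial (∑ j ∈ T, Finsupp.single j 1) (1 : K) = ∏ j ∈ T, X j :=
      monomial_sum_one T (fun j => Finsupp.single j 1)
    rw [← e, monomial_mul, one_mul]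

lemma span_eq (G : SimpleGraph (Fin n)) (r : ℕ) :
    {m | ∃ (l : ℕ) (W : Fin l → Finset (Fin n)),
            (∀ i, G.IsClique (W i : Set (Fin n)) ∧ 2 ≤ (W i).card) ∧
            (∑ i, ((W i).card - 1)) = r ∧
            m = ∏ i, ∏ j ∈ W i, (X j : MvPolynomial (Fin n) K)} =
    (fun s => monomial s (1 : K)) '' (cnt '' {M | Good G r M}) := by
  ext m
  constructor
  · rintro ⟨l, W, h1, h2, rfl⟩
    refine ⟨_, ⟨(Finset.univ : Finset (Fin l)).val.map W, ⟨?_, ?_⟩, rfl⟩, ?_⟩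
    · intro T hT
      obtain ⟨i, -, rfl⟩ := Multiset.mem_map.1 hT
      exact h1 i
    · rw [Multiset.map_map]; exact h2
    · dsimp only
      rw [← prod_eq_cnt, Multiset.map_map]; rfl
  · rintro ⟨_, ⟨M, ⟨h1, h2⟩, rfl⟩, rfl⟩
    obtain ⟨l, W, rfl⟩ : ∃ (l : ℕ) (W : Fin l → Finset (Fin n)),
        M = (Finset.univ : Finset (Fin l)).val.map W := by
      obtain ⟨L, rfl⟩ := Quot.exists_rep M
      refine ⟨L.length, L.get, ?_⟩
      rw [Fin.univ_val_map, List.ofFn_get]; rfl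
    refine ⟨l, W, ?_, ?_, ?_⟩
    · intro i
      exact h1 _ (Multiset.mem_map_of_mem _ (Finset.mem_univ_val i))
    · rw [Multiset.map_map] at h2; exact h2
    · dsimp only
      rw [← prod_eq_cnt, Multiset.map_map]; rfl

lemma shrink (G : SimpleGraph (Fin n)) (M : Multiset (Finset (Fin n))) :
    ∀ r, (∀ T ∈ M, G.IsClique (T : Set (Fin n))) →
    r ≤ (M.map (fun T => T.card - 1)).sum → ∃ M', Good G r M' ∧ cnt M' ≤ cnt M := by
  induction M using Multiset.induction_on with
  | empty =>
    intro r _ h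
    simp at h
    exact ⟨0, ⟨by simp, by simp [h]⟩, le_rfl⟩
  | cons T M ih =>
    intro r hM h
    have hM' : ∀ T ∈ M, G.IsClique (T : Set (Fin n)) := fun S hS => hM S (Multiset.mem_cons_of_mem hS)
    by_cases hr : r ≤ (M.map (fun T => T.card - 1)).sum
    · obtain ⟨M', h1, h2⟩ := ih r hM' hr
      refine ⟨M', h1, fun v => (h2 v).trans ?_⟩
      simp only [cnt_apply, Multiset.countP_cons]; omega
    · obtain ⟨M', ⟨h1, h1'⟩, h2⟩ := ih _ hM' le_rfl
      rw [Multiset.map_cons, Multiset.sum_cons] at h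
      obtain ⟨T', hT', hc⟩ := Finset.exists_subset_card_eq
        (s := T) (n := r - (M.map (fun T => T.card - 1)).sum + 1) (by omega)
      refine ⟨T' ::ₘ M', ⟨?_, ?_⟩, ?_⟩
      · intro S hS
        rcases Multiset.mem_cons.1 hS with rfl | hS
        · exact ⟨(hM T (Multiset.mem_cons_self _ _)).subset (by simpa using hT'), by omega⟩
        · exact h1 S hS
      · rw [Multiset.map_cons, Multiset.sum_cons, h1', hc]; omega
      · intro v
        have := h2 v
        simp only [cnt_apply, Multiset.countP_cons] at this ⊢
        have := @hT' v
        split_ifs <;> first | omega | tauto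

lemma sum_card_split (M : Multiset (Finset (Fin n))) :
    (M.map (fun T => T.card)).sum ≤ (M.map (fun T => T.card - 1)).sum + M.card := by
  induction M using Multiset.induction_on with
  | empty => simp
  | cons T M ih =>
    simp only [Multiset.map_cons, Multiset.sum_cons, Multiset.card_cons]; omega

lemma sum_card_split' (M : Multiset (Finset (Fin n))) (h : ∀ T ∈ M, 2 ≤ T.card) :
    (M.map (fun T => T.card)).sum = (M.map (fun T => T.card - 1)).sum + M.card := by
  induction M using Multiset.induction_on with
  | empty => simp
  | cons T M ih =>
    have := ih (fun S hS => h S (Multiset.mem_cons_of_mem hS))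
    have := h T (Multiset.mem_cons_self _ _)
    simp only [Multiset.map_cons, Multiset.sum_cons, Multiset.card_cons]; omega

lemma good_imp (G : SimpleGraph (Fin n)) (r : ℕ) (M : Multiset (Finset (Fin n))) (hM : Good G r M)
    (a : Fin n →₀ ℕ) (ha : cnt M ≤ a) (S : Finset (Fin n)) (hS : Gᶜ.IsClique (S : Set (Fin n))) :
    r ≤ ∑ i ∈ Sᶜ, a i := by
  refine le_trans ?_ (Finset.sum_le_sum (fun i _ => ha i))
  simp only [cnt_apply]
  rw [sum_countP, ← hM.2]
  apply Multiset.sum_map_le_sum_map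
  intro T hT
  have h1 := inter_card_le (hM.1 T hT).1 hS
  have h2 := Finset.card_inter_add_card_sdiff T S
  rw [← Finset.sdiff_eq_inter_compl]
  rw [Finset.inter_comm] at h1
  omega

lemma good_of_wt (G : SimpleGraph (Fin n)) (hW : WtP G) (r : ℕ) (a : Fin n →₀ ℕ)
    (h : ∀ S : Finset (Fin n), Gᶜ.IsClique (S : Set (Fin n)) → r ≤ ∑ i ∈ Sᶜ, a i) :
    ∃ M, Good G r M ∧ cnt M ≤ a := by
  have h0 := h ∅ (by simp)
  simp only [Finset.compl_empty] at h0
  obtain ⟨M, h1, h2, h3⟩ := hW a (∑ i, a i - r) (by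
    intro T hT
    have := h T hT
    rw [← Finset.sum_add_sum_compl T] at h0 ⊢
    omega)
  have hcnt : cnt M = a := by ext v; rw [cnt_apply, h3]
  rw [← hcnt]
  apply shrink G M r h2
  have e := sum_countP M Finset.univ
  simp only [h3, Finset.inter_univ] at e
  have := sum_card_split M
  omega

lemma CCov.mono {G : SimpleGraph (Fin n)} {k l : ℕ} {a : Fin n → ℕ} (h : CCov G k a) (hkl : k ≤ l) :
    CCov G l a := by
  induction l, hkl using Nat.le_induction with
  | base => exact h
  | succ m _ ih => exact ih.cons ∅ (by simp) (by simp)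

lemma un_of_good (G : SimpleGraph (Fin n)) (r : ℕ) (U : Finset (Fin n))
    (M : Multiset (Finset (Fin n))) (hM : Good G r M)
    (h : ∀ v, cnt M v ≤ if v ∈ U then 1 else 0) :
    CCov G (U.card - r) (fun v => if v ∈ U then 1 else 0) := by
  classical
  refine ⟨M + (U.filter (fun v => cnt M v = 0)).val.map (fun v => {v}), ?_, ?_, ?_⟩
  · rw [Multiset.card_add, Multiset.card_map]
    change _ + (U.filter (fun v => cnt M v = 0)).card = _
    have e1 : (U.filter (fun v => cnt M v = 0)).card + ∑ v, cnt M v = U.card := by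
      rw [← Finset.sum_subset (Finset.subset_univ U), Finset.card_filter, ← Finset.sum_add_distrib,
        Finset.card_eq_sum_ones]
      · apply Finset.sum_congr rfl
        intro v hv
        have := h v
        rw [if_pos hv] at this
        split_ifs <;> omega
      · intro v _ hv
        have := h v
        rw [if_neg hv] at this
        omega
    have e2 := sum_countP M Finset.univ
    have e3 := sum_card_split' M (fun T hT => (hM.1 T hT).2)
    rw [hM.2] at e3
    simp only [Finset.inter_univ] at e2
    simp only [cnt_apply] at e1 ⊢
    omega
  · intro T hT
    rcases Multiset.mem_add.1 hT with hT | hT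
    · exact (hM.1 T hT).1
    · obtain ⟨v, -, rfl⟩ := Multiset.mem_map.1 hT
      simp
  · intro v
    rw [Multiset.countP_add, Multiset.countP_map]
    change _ + (Finset.filter _ (U.filter (fun v => cnt M v = 0))).card = _
    have hv := h v
    rw [← cnt_apply]
    have e : (Finset.filter (fun w => v ∈ ({w} : Finset (Fin n))) (U.filter (fun v => cnt M v = 0)))
        = if v ∈ U ∧ cnt M v = 0 then {v} else ∅ := by
      ext w
      split_ifs with hc
      · simp only [Finset.mem_filter, Finset.mem_singleton]
        constructor
        · rintro ⟨_, rfl⟩; rfl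
        · rintro rfl; exact ⟨hc, rfl⟩
      · simp only [Finset.mem_filter, Finset.mem_singleton, Finset.notMem_empty, iff_false]
        rintro ⟨h1, rfl⟩; exact hc h1
    rw [e]
    by_cases h1 : v ∈ U <;> by_cases h2 : cnt M v = 0 <;> simp [h1, h2] at hv ⊢
    omega
end Alg

/-- a finite simple graph `G` is perfect iff for every `r ≥ 1` the `r`-th
symbolic power of its edge ideal is generated by products of (monomials of) cliques
`V_1, ..., V_l` of cardinality at least 2 with `∑ (|V_i| - 1) = r`. -/
theorem isPerfect_iff_symbolicPower_edgeIdeal {K : Type*} [Field K] {n : ℕ}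
    (G : SimpleGraph (Fin n)) :
    IsPerfect G ↔
      ∀ r : ℕ, 1 ≤ r →
        symbolicPower (graphEdgeIdeal K G) r =
          Ideal.span {m | ∃ (l : ℕ) (W : Fin l → Finset (Fin n)),
            (∀ i, G.IsClique (W i : Set (Fin n)) ∧ 2 ≤ (W i).card) ∧
            (∑ i, ((W i).card - 1)) = r ∧
            m = ∏ i, ∏ j ∈ W i, (X j : MvPolynomial (Fin n) K)} := by
  simp only [span_eq]
  constructor
  · intro hp r _
    have hW : WtP G := by
      have h := step2 (step1 ((perfect_iff G).1 hp))
      rw [compl_compl] at h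
      exact step1 h
    ext f
    rw [mem_symb_iff, mem_ideal_span_monomial_image]
    constructor
    · intro h a ha
      obtain ⟨M, hM, hle⟩ := good_of_wt G hW r a (h a ha)
      exact ⟨_, ⟨M, hM, rfl⟩, hle⟩
    · intro h a ha S hS
      obtain ⟨_, ⟨M, hM, rfl⟩, hle⟩ := h a ha
      exact good_imp G r M hM a hle S hS
  · intro h
    rw [perfect_iff]
    refine step2 (step1 ?_)
    intro U k hk
    refine CCov.mono (k := U.card - (U.card - k)) ?_ (by omega)
    by_cases hr : U.card - k = 0
    · rw [hr]
      exact un_of_good G 0 U 0 ⟨by simp, by simp⟩ (by simp [cnt_apply])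
    · let a : Fin n →₀ ℕ := Finsupp.equivFunOnFinite.symm (fun v => if v ∈ U then 1 else 0)
      have ha : ∀ v, a v = if v ∈ U then 1 else 0 := fun v => rfl
      have hsupp : (monomial a (1 : K)).support = {a} := by
        classical
        rw [support_monomial, if_neg one_ne_zero]
      have hmem : monomial a (1 : K) ∈ symbolicPower (graphEdgeIdeal K G) (U.card - k) := by
        apply symb_of_mono
        intro S hS
        have h1 := hk (U ∩ S) Finset.inter_subset_left (hS.subset (by simp))
        have h2 := Finset.card_inter_add_card_sdiff U S
        have h3 : ∑ i ∈ Sᶜ, a i = (U \ S).card := by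
          simp only [ha, Finset.sum_ite_mem, Finset.sum_const, smul_eq_mul, mul_one]
          rw [Finset.sdiff_eq_inter_compl, Finset.inter_comm]
        omega
      rw [h _ (by omega), mem_ideal_span_monomial_image] at hmem
      obtain ⟨_, ⟨M, hM, rfl⟩, hle⟩ := hmem a (by rw [hsupp]; simp)
      exact un_of_good G _ U M hM (fun v => (hle v).trans_eq (ha v))
end

section
/- Let P be a finite poset with antichain ideal J(P)^{{r}} generated by the (r+1)-element antichains. Then for all s ≥ 1, (J(P)^{{r}})^{(s)} is generated by the monomials ∏_{i=1}^l m_{A_i} where each A_i is an antichain of P with |A_i| ≥ r+1 and ∑_{i=1}^l (|A_i| − r) = s. -/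
open MvPolynomial

/-- The antichain ideal `J(P)^{{r}}`, generated by the `(r+1)`-element antichains. -/
noncomputable def antichainIdeal (K : Type*) [Field K] (P : Type*) [Fintype P]
    [DecidableEq P] [PartialOrder P] (r : ℕ) : Ideal (MvPolynomial P K) :=
  Ideal.span {m | ∃ A : Finset P, IsAntichain (· ≤ ·) (A : Set P) ∧ A.card = r + 1 ∧
    m = ∏ i ∈ A, X i}


/-- Egervary-type duality, via Hall's theorem. -/
lemma egervary {α : Type*} [Fintype α] [DecidableEq α] (E : α → α → Prop) (hE : ∀ i, E i i)
    (w : α → α → ℤ) : ∃ (u v : α → ℤ) (f : α → α), Function.Injective f ∧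
      (∀ i j, E i j → w i j ≤ u i + v j) ∧ ∀ i, E i (f i) ∧ u i + v (f i) = w i (f i) := by
  classical
  obtain ⟨m, ⟨u, v, hf, hm⟩, hmin⟩ := Int.exists_least_of_bdd
    (P := fun z => ∃ u v : α → ℤ, (∀ i j, E i j → w i j ≤ u i + v j) ∧
      ∑ i, u i + ∑ i, v i = z)
    ⟨∑ i, w i i, by
      rintro z ⟨u, v, h, rfl⟩
      rw [← Finset.sum_add_distrib]
      exact Finset.sum_le_sum fun i _ => h i i (hE i)⟩
    ⟨_, fun i => ∑ j, |w i j|, 0, by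
      intro i j _
      simp only [Pi.zero_apply, add_zero]
      exact (le_abs_self _).trans
        (Finset.single_le_sum (f := fun j => |w i j|) (fun _ _ => abs_nonneg _)
          (Finset.mem_univ j)), rfl⟩
  have hall := (Fintype.all_card_le_filter_rel_iff_exists_injective
    (fun i j => E i j ∧ u i + v j = w i j)).1 (by
    intro A
    by_contra hlt
    push Not at hlt
    set N : Finset α := Finset.univ.filter (fun b => ∃ a ∈ A, E a b ∧ u a + v b = w a b) with hN
    have := hmin _ ⟨fun i => u i - (if i ∈ A then 1 else 0),
      fun j => v j + (if j ∈ N then 1 else 0), by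
        intro i j hij
        have h1 := hf i j hij
        by_cases hi : i ∈ A
        · by_cases hj : j ∈ N
          · simp [hi, hj]; linarith
          · have : u i + v j ≠ w i j := fun h => hj (by
              rw [hN, Finset.mem_filter]; exact ⟨Finset.mem_univ _, i, hi, hij, h⟩)
            simp only [hi, hj, if_true, if_false]
            omega
        · by_cases hj : j ∈ N <;> simp only [hi, hj, if_true, if_false] <;> omega, rfl⟩
    rw [Finset.sum_sub_distrib, Finset.sum_add_distrib] at this
    simp only [Finset.sum_ite_mem, Finset.univ_inter, Finset.sum_const, nsmul_eq_mul, mul_one]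
      at this
    have h2 : (N.card : ℤ) < A.card := by exact_mod_cast hlt
    omega)
  obtain ⟨f, hfi, hft⟩ := hall
  exact ⟨u, v, f, hfi, hf, hft⟩

lemma greene_dual {P : Type*} [Fintype P] [DecidableEq P] [PartialOrder P] (r : ℕ) (hr : 1 ≤ r)
    (a : P → ℕ) : ∃ (C : Finset P),
    (∀ A : Finset P, IsAntichain (· ≤ ·) (A : Set P) → A ⊆ C → A.card ≤ r) ∧
    ∃ (L : ℕ) (B : ℕ → Finset P), (∀ j, IsAntichain (· ≤ ·) (B j : Set P)) ∧
      (∀ p, ((Finset.range L).filter (fun j => p ∈ B j)).card ≤ a p) ∧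
      ∑ i ∈ Cᶜ, a i + r * L ≤ ∑ j ∈ Finset.range L, (B j).card := by
  classical
  let E : P ⊕ Fin r → P ⊕ Fin r → Prop := fun x y =>
    match x, y with
    | .inl p, .inl q => p ≤ q
    | _, _ => True
  let w : P ⊕ Fin r → P ⊕ Fin r → ℤ := fun x y =>
    match x with
    | .inl p => if y = .inl p then 0 else a p
    | .inr _ => 0
  obtain ⟨u, v, f, hinj, hle, heq⟩ := egervary E (by rintro (p | k) <;> simp [E]) w
  have hbij : Function.Bijective f := Finite.injective_iff_bijective.1 hinj
  have : Nonempty (Fin r) := ⟨⟨0, hr⟩⟩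
  obtain ⟨k0, hk0⟩ := Finite.exists_min (fun k : Fin r => u (.inr k))
  obtain ⟨l0, hl0⟩ := Finite.exists_min (fun k : Fin r => v (.inr k))
  set U := u (.inr k0)
  set V := v (.inr l0)
  let C : Finset P := Finset.univ.filter (fun p => f (.inl p) ≠ .inl p)
  have hsum : ∑ p, u (.inl p) + ∑ k, u (.inr k) + (∑ p, v (.inl p) + ∑ k, v (.inr k))
      = ∑ p ∈ C, (a p : ℤ) := by
    rw [← Fintype.sum_sum_type, ← Fintype.sum_sum_type, ← hbij.sum_comp v,
      ← Finset.sum_add_distrib, Finset.sum_congr rfl (fun i _ => (heq i).2), Fintype.sum_sum_type]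
    simp only [w, C, Finset.sum_const_zero, add_zero, Finset.sum_filter]
    refine Finset.sum_congr rfl fun p _ => ?_
    by_cases h : f (.inl p) = .inl p <;> simp [h]
  have hU : (r : ℤ) * U ≤ ∑ k, u (.inr k) := by
    have := Finset.card_nsmul_le_sum Finset.univ (fun k : Fin r => u (.inr k)) U (fun k _ => hk0 k)
    simpa using this
  have hV : (r : ℤ) * V ≤ ∑ k, v (.inr k) := by
    have := Finset.card_nsmul_le_sum Finset.univ (fun k : Fin r => v (.inr k)) V (fun k _ => hl0 k)
    simpa using this
  have hUV : 0 ≤ U + V := hle (.inr k0) (.inr l0) trivial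
  -- potentials
  let pin : P → ℤ := fun p => v (.inl p) + U
  let pout : P → ℤ := fun p => a p - u (.inl p) + U
  have h0 : ∀ p, 0 ≤ pin p := fun p => by
    have := hle (.inr k0) (.inl p) trivial
    simp only [w] at this; simp only [pin]; linarith
  have hL : ∀ p, pout p ≤ U + V := fun p => by
    have := hle (.inl p) (.inr l0) trivial
    simp [w] at this; simp only [pout]; linarith
  have hself : ∀ p, pout p - pin p ≤ a p := fun p => by
    have := hle (.inl p) (.inl p) le_rfl
    simp [w] at this; simp only [pout, pin]; linarith
  have hlt : ∀ p q, p < q → pout p ≤ pin q := fun p q hpq => by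
    have := hle (.inl p) (.inl q) hpq.le
    have hne : q ≠ p := hpq.ne'
    simp [w, hne] at this; simp only [pout, pin]; linarith
  refine ⟨C, ?_, (U + V).toNat, fun j => Finset.univ.filter (fun p => pin p ≤ j ∧ (j : ℤ) < pout p),
    ?_, ?_, ?_⟩
  · intro A hA hAC
    let W : Finset P := C.filter (fun q => ∃ p ∈ A, p < q)
    have hdisj : Disjoint A W := by
      rw [Finset.disjoint_left]
      intro q hq hqW
      obtain ⟨_, p, hp, hpq⟩ := Finset.mem_filter.1 hqW
      exact hA hp hq hpq.ne hpq.le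
    have hsub : ((A ∪ W).map ⟨Sum.inl, Sum.inl_injective⟩).image f ⊆
        Finset.disjSum W (Finset.univ : Finset (Fin r)) := by
      intro y hy
      simp only [Finset.mem_image, Finset.mem_map, Function.Embedding.coeFn_mk] at hy
      obtain ⟨x, ⟨p, hp, rfl⟩, rfl⟩ := hy
      have hpC : f (.inl p) ≠ .inl p := by
        have : p ∈ C := by
          rcases Finset.mem_union.1 hp with h | h
          · exact hAC h
          · exact (Finset.mem_filter.1 h).1
        exact (Finset.mem_filter.1 this).2
      have hEp := (heq (.inl p)).1
      rcases hq : f (.inl p) with q | k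
      · rw [hq] at hEp hpC
        have hpq : p < q := lt_of_le_of_ne hEp (fun h => hpC (by rw [h]))
        refine Finset.inl_mem_disjSum.2 (Finset.mem_filter.2 ⟨Finset.mem_filter.2 ⟨Finset.mem_univ _, ?_⟩, ?_⟩)
        · intro h
          have := hinj (hq.trans h.symm)
          exact hpq.ne (Sum.inl_injective this)
        · rcases Finset.mem_union.1 hp with h | h
          · exact ⟨p, h, hpq⟩
          · obtain ⟨_, p', hp', h'⟩ := Finset.mem_filter.1 h
            exact ⟨p', hp', h'.trans hpq⟩
      · simp
    have := Finset.card_le_card hsub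
    rw [Finset.card_image_of_injective _ hinj, Finset.card_map, Finset.card_union_of_disjoint hdisj,
      Finset.card_disjSum, Finset.card_univ, Fintype.card_fin] at this
    omega
  · intro j p hp q hq hne hpq
    simp only [Finset.coe_filter, Finset.mem_univ, true_and, Set.mem_ofPred_eq] at hp hq
    have := hlt p q (lt_of_le_of_ne hpq hne)
    omega
  · intro p
    have : ((Finset.range (U + V).toNat).filter (fun j : ℕ => p ∈ Finset.univ.filter
        (fun p => pin p ≤ (j : ℤ) ∧ (j : ℤ) < pout p))) ⊆ Finset.Ico (pin p).toNat (pout p).toNat := by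
      intro j hj
      simp only [Finset.mem_filter, Finset.mem_univ, true_and, Finset.mem_range] at hj
      have := h0 p
      rw [Finset.mem_Ico]; omega
    refine (Finset.card_le_card this).trans ?_
    rw [Nat.card_Ico]
    have := h0 p
    have := hself p
    omega
  · have hcount : ∑ j ∈ Finset.range (U + V).toNat, (Finset.univ.filter
        (fun p => pin p ≤ (j : ℤ) ∧ (j : ℤ) < pout p)).card =
        ∑ p, ((pout p).toNat - (pin p).toNat) := by
      simp only [Finset.card_filter]
      rw [Finset.sum_comm]
      refine Finset.sum_congr rfl fun p _ => ?_
      rw [← Finset.card_filter, ← Nat.card_Ico]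
      congr 1
      ext j
      have := h0 p
      have := hL p
      simp only [Finset.mem_filter, Finset.mem_range, Finset.mem_Ico]
      omega
    rw [hcount]
    have h1 : ∑ p, (pout p - pin p) ≤ ((∑ p, ((pout p).toNat - (pin p).toNat) : ℕ) : ℤ) := by
      push_cast
      refine Finset.sum_le_sum fun p _ => ?_
      have := h0 p
      omega
    have h2 : ∑ p, (pout p - pin p) = ∑ p, (a p : ℤ) - ∑ p, u (.inl p) - ∑ p, v (.inl p) := by
      rw [← Finset.sum_sub_distrib, ← Finset.sum_sub_distrib]
      refine Finset.sum_congr rfl fun p _ => ?_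
      simp only [pin, pout]; ring
    have h3 : ∑ p ∈ C, (a p : ℤ) + ∑ p ∈ Cᶜ, (a p : ℤ) = ∑ p, (a p : ℤ) :=
      Finset.sum_add_sum_compl C _
    zify
    rw [Int.toNat_of_nonneg hUV]
    push_cast at h1 ⊢
    linarith

lemma trim {P : Type*} [DecidableEq P] [PartialOrder P] (r : ℕ) (B : ℕ → Finset P)
    (hB : ∀ j, IsAntichain (· ≤ ·) (B j : Set P)) (L s : ℕ)
    (h : s ≤ ∑ j ∈ Finset.range L, ((B j).card - r)) :
    ∃ (l : ℕ) (A : Fin l → Finset P),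
      (∀ i, IsAntichain (· ≤ ·) ((A i : Finset P) : Set P) ∧ r + 1 ≤ (A i).card) ∧
      (∑ i, ((A i).card - r)) = s ∧
      ∀ p, (Finset.univ.filter (fun i => p ∈ A i)).card ≤
        ((Finset.range L).filter (fun j => p ∈ B j)).card := by
  classical
  induction L generalizing s with
  | zero =>
    have : s = 0 := by simpa using h
    subst this
    exact ⟨0, Fin.elim0, fun i => i.elim0, by simp, by simp⟩
  | succ L ih =>
    rw [Finset.sum_range_succ] at h
    have hmono : ∀ p, ((Finset.range L).filter (fun j => p ∈ B j)).card ≤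
        ((Finset.range (L+1)).filter (fun j => p ∈ B j)).card := fun p =>
      Finset.card_le_card (Finset.filter_subset_filter _ (Finset.range_subset_range.2 (Nat.le_succ L)))
    by_cases hs : s ≤ ∑ j ∈ Finset.range L, ((B j).card - r)
    · obtain ⟨l, A, h1, h2, h3⟩ := ih s hs
      exact ⟨l, A, h1, h2, fun p => (h3 p).trans (hmono p)⟩
    · push Not at hs
      obtain ⟨l, A, h1, h2, h3⟩ := ih _ le_rfl
      set T := ∑ j ∈ Finset.range L, ((B j).card - r)
      obtain ⟨D, hD, hDc⟩ := Finset.exists_subset_card_eq (s := B L) (n := s - T + r) (by omega)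
      refine ⟨l + 1, Fin.cons D A, ?_, ?_, ?_⟩
      · intro i
        refine Fin.cases ?_ (fun i => ?_) i
        · simp only [Fin.cons_zero]
          exact ⟨(hB L).subset (by exact_mod_cast hD), by omega⟩
        · simpa using h1 i
      · rw [Fin.sum_univ_succ]
        simp only [Fin.cons_zero, Fin.cons_succ, h2]
        omega
      · intro p
        have := h3 p
        rw [Finset.card_filter, Fin.sum_univ_succ]
        simp only [Fin.cons_zero, Fin.cons_succ]
        rw [← Finset.card_filter, Finset.card_filter _ (Finset.range (L+1)), Finset.sum_range_succ,
          ← Finset.card_filter]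
        have : (if p ∈ D then 1 else 0) ≤ (if p ∈ B L then 1 else 0) := by
          split_ifs with h1 h2 <;> simp_all
          exact h2 (hD h1)
        omega

lemma comb_main {P : Type*} [Fintype P] [DecidableEq P] [PartialOrder P] (r : ℕ) (hr : 1 ≤ r)
    (s : ℕ) (a : P → ℕ) (h : ∀ C : Finset P,
      (∀ A : Finset P, IsAntichain (· ≤ ·) (A : Set P) → A ⊆ C → A.card ≤ r) → s ≤ ∑ i ∈ Cᶜ, a i) :
    ∃ (l : ℕ) (A : Fin l → Finset P),
      (∀ i, IsAntichain (· ≤ ·) ((A i : Finset P) : Set P) ∧ r + 1 ≤ (A i).card) ∧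
      (∑ i, ((A i).card - r)) = s ∧
      ∀ p, (Finset.univ.filter (fun i => p ∈ A i)).card ≤ a p := by
  obtain ⟨C, hC, L, B, hB, hBa, hsum⟩ := greene_dual r hr a
  have h1 := h C hC
  obtain ⟨l, A, hA, hs, hp⟩ := trim r B hB L s (by
    have : ∑ j ∈ Finset.range L, (B j).card ≤ ∑ j ∈ Finset.range L, (((B j).card - r) + r) :=
      Finset.sum_le_sum fun j _ => by omega
    rw [Finset.sum_add_distrib, Finset.sum_const, Finset.card_range, smul_eq_mul, mul_comm L] at this
    omega)
  exact ⟨l, A, hA, hs, fun p => (hp p).trans (hBa p)⟩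

lemma mem_symbolicPower_iff {R : Type*} [CommRing R] (I : Ideal R) (s : ℕ) (f : R) :
    f ∈ symbolicPower I s ↔ ∃ t ∈ symbCompl I, t * f ∈ I ^ s := by
  rw [symbolicPower, Ideal.mem_comap]
  exact IsLocalization.algebraMap_mem_map_algebraMap_iff (symbCompl I) _ _ _

lemma prod_X_eq_monomial {K : Type*} [Field K] {P : Type*} [DecidableEq P] (A : Finset P) :
    ∏ i ∈ A, (X i : MvPolynomial P K) = monomial (∑ i ∈ A, Finsupp.single i 1) 1 := by
  rw [monomial_sum_one]
  rfl

lemma sum_single_apply' {P : Type*} [DecidableEq P] (A : Finset P) (p : P) :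
    (∑ i ∈ A, Finsupp.single i 1 : P →₀ ℕ) p = if p ∈ A then 1 else 0 := by
  rw [Finsupp.finsetSum_apply]
  simp [Finsupp.single_apply]

lemma mem_antichainIdeal_iff {K : Type*} [Field K] {P : Type*} [Fintype P]
    [DecidableEq P] [PartialOrder P] (r : ℕ) (f : MvPolynomial P K) :
    f ∈ antichainIdeal K P r ↔ ∀ a ∈ f.support, ∃ A : Finset P,
      IsAntichain (· ≤ ·) (A : Set P) ∧ A.card = r + 1 ∧ ∀ i ∈ A, 1 ≤ a i := by
  have : antichainIdeal K P r = Ideal.span ((fun s => monomial s (1 : K)) ''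
      {b | ∃ A : Finset P, IsAntichain (· ≤ ·) (A : Set P) ∧ A.card = r + 1 ∧
        b = ∑ i ∈ A, Finsupp.single i 1}) := by
    rw [antichainIdeal]
    congr 1
    ext m
    constructor
    · rintro ⟨A, h1, h2, rfl⟩
      exact ⟨_, ⟨A, h1, h2, rfl⟩, (prod_X_eq_monomial A).symm⟩
    · rintro ⟨_, ⟨A, h1, h2, rfl⟩, rfl⟩
      exact ⟨A, h1, h2, (prod_X_eq_monomial A).symm⟩
  rw [this, mem_ideal_span_monomial_image]
  refine forall₂_congr fun a _ => ?_
  constructor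
  · rintro ⟨_, ⟨A, h1, h2, rfl⟩, h⟩
    refine ⟨A, h1, h2, fun i hi => ?_⟩
    have := h i
    rwa [sum_single_apply', if_pos hi] at this
  · rintro ⟨A, h1, h2, h⟩
    refine ⟨_, ⟨A, h1, h2, rfl⟩, fun i => ?_⟩
    rw [sum_single_apply']
    split_ifs with hi
    · exact h i hi
    · exact Nat.zero_le _

lemma prod_mem_antichainIdeal {K : Type*} [Field K] {P : Type*} [Fintype P]
    [DecidableEq P] [PartialOrder P] (r : ℕ) (A : Finset P)
    (hA : IsAntichain (· ≤ ·) (A : Set P)) (hc : A.card = r + 1) :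
    ∏ i ∈ A, X i ∈ antichainIdeal K P r :=
  Ideal.subset_span ⟨A, hA, hc, rfl⟩

lemma mul_X_mem_of_mul_X_pow {K : Type*} [Field K] {P : Type*} [Fintype P]
    [DecidableEq P] [PartialOrder P] (r n : ℕ) (t : MvPolynomial P K) (i : P)
    (h : t * X i ^ n ∈ antichainIdeal K P r) : t * X i ∈ antichainIdeal K P r := by
  rw [mem_antichainIdeal_iff] at h ⊢
  intro a ha
  rw [support_mul_X, Finset.mem_map] at ha
  obtain ⟨b, hb, rfl⟩ := ha
  obtain ⟨A, h1, h2, h3⟩ := h (b + Finsupp.single i n) (by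
    rw [mem_support_iff, X_pow_eq_monomial, coeff_mul_monomial, mul_one]
    exact mem_support_iff.1 hb)
  refine ⟨A, h1, h2, fun j hj => ?_⟩
  have := h3 j hj
  simp only [addRightEmbedding_apply, Finsupp.add_apply, Finsupp.single_apply] at this ⊢
  split_ifs at this ⊢ <;> omega

lemma exists_mul_X_mem {K : Type*} [Field K] {P : Type*} [Fintype P]
    [DecidableEq P] [PartialOrder P] (r : ℕ) (p : Ideal (MvPolynomial P K))
    (hp : p ∈ (antichainIdeal K P r).minimalPrimes) (i : P) (hi : X i ∈ p) :
    ∃ t ∉ p, t * X i ∈ antichainIdeal K P r := by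
  have : p.IsPrime := hp.1.1
  have h := IsLocalization.AtPrime.radical_map_of_mem_minimalPrimes
    (A := Localization.AtPrime p) p _ hp
  have h2 : algebraMap _ (Localization.AtPrime p) (X i : MvPolynomial P K) ∈
      ((antichainIdeal K P r).map (algebraMap _ (Localization.AtPrime p))).radical := by
    rw [h]; exact Ideal.mem_map_of_mem _ hi
  obtain ⟨n, hn⟩ := h2
  rw [← map_pow, IsLocalization.algebraMap_mem_map_algebraMap_iff p.primeCompl] at hn
  obtain ⟨t, ht, hm⟩ := hn
  exact ⟨t, ht, mul_X_mem_of_mul_X_pow r n t i hm⟩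

lemma gen_mem {K : Type*} [Field K] {P : Type*} [Fintype P]
    [DecidableEq P] [PartialOrder P] (r : ℕ) (A : Finset P)
    (hA : IsAntichain (· ≤ ·) (A : Set P)) :
    ∃ t ∈ symbCompl (antichainIdeal K P r),
      t * ∏ i ∈ A, X i ∈ antichainIdeal K P r ^ (A.card - r) := by
  classical
  set I := antichainIdeal K P r with hI
  let J : Ideal (MvPolynomial P K) :=
    Submodule.comap (LinearMap.mulRight (MvPolynomial P K) (∏ i ∈ A, (X i : MvPolynomial P K)))
      (I ^ (A.card - r))
  have hJ : ∀ t, t ∈ J ↔ t * ∏ i ∈ A, X i ∈ I ^ (A.card - r) := fun t => Iff.rfl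
  have hfin := I.finite_minimalPrimes_of_isNoetherianRing
  by_contra hcon
  push Not at hcon
  have hsub : (J : Set (MvPolynomial P K)) ⊆ ⋃ p ∈ (↑hfin.toFinset : Set (Ideal (MvPolynomial P K))), ((p : Ideal (MvPolynomial P K)) : Set (MvPolynomial P K)) := by
    intro t ht
    have h1 : t ∉ symbCompl I := fun h => hcon t h ((hJ t).1 ht)
    have h2 : ¬ ∀ p ∈ I.minimalPrimes, t ∉ p := h1
    push Not at h2
    obtain ⟨p, hp, htp⟩ := h2
    simp only [Set.mem_iUnion]
    exact ⟨p, by simpa using hp, htp⟩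
  rw [Ideal.subset_union_prime ⊥ ⊥ (fun p hp _ _ => (hfin.mem_toFinset.1 hp).1.1)] at hsub
  obtain ⟨p, hp, hle⟩ := hsub
  rw [hfin.mem_toFinset] at hp
  have hprime : p.IsPrime := hp.1.1
  let S := A.filter (fun i => (X i : MvPolynomial P K) ∈ p)
  have hS : A.card - r ≤ S.card := by
    by_contra hlt
    push Not at hlt
    have hc : S.card + (A.filter (fun i => ¬ (X i : MvPolynomial P K) ∈ p)).card = A.card :=
      Finset.card_filter_add_card_filter_not _
    obtain ⟨D, hD, hDc⟩ := Finset.exists_subset_card_eq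
      (s := A.filter (fun i => ¬ (X i : MvPolynomial P K) ∈ p)) (n := r + 1) (by omega)
    have h1 : ∏ i ∈ D, (X i : MvPolynomial P K) ∈ p :=
      hp.1.2 (prod_mem_antichainIdeal r D (hA.subset (by
        exact_mod_cast hD.trans (Finset.filter_subset _ _))) hDc)
    obtain ⟨i, hi, hXi⟩ := hprime.prod_mem_iff.1 h1
    exact (Finset.mem_filter.1 (hD hi)).2 hXi
  have hex : ∀ i, ∃ t, t ∉ p ∧ (i ∈ S → t * X i ∈ I) := by
    intro i
    by_cases hi : i ∈ S
    · obtain ⟨t, ht, h⟩ := exists_mul_X_mem r p hp i (Finset.mem_filter.1 hi).2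
      exact ⟨t, ht, fun _ => h⟩
    · exact ⟨1, fun h => hprime.ne_top ((Ideal.eq_top_iff_one p).2 h), fun h => absurd h hi⟩
  choose t ht1 ht2 using hex
  have hmem : ∏ i ∈ S, t i ∈ J := by
    rw [hJ, ← Finset.prod_filter_mul_prod_filter_not A (fun i => (X i : MvPolynomial P K) ∈ p),
      ← mul_assoc, ← Finset.prod_mul_distrib]
    refine Ideal.mul_mem_right _ _ (Ideal.pow_le_pow_right hS ?_)
    have := Ideal.prod_mem_prod (s := S) (I := fun _ => I) (x := fun i => t i * X i)
      (fun i hi => ht2 i hi)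
    rwa [Finset.prod_const] at this
  obtain ⟨i, _, hi⟩ := hprime.prod_mem_iff.1 (hle hmem)
  exact ht1 i hi

/-- The grading map scaling the variables in `S` by `T`. -/
noncomputable def scaleMap (K : Type*) [Field K] {P : Type*} [DecidableEq P] (S : Finset P) :
    MvPolynomial P K →ₐ[K] Polynomial (MvPolynomial P K) :=
  aeval (fun i => if i ∈ S then Polynomial.X * Polynomial.C (X i) else Polynomial.C (X i))

lemma scaleMap_monomial {K : Type*} [Field K] {P : Type*} [Fintype P] [DecidableEq P] (S : Finset P)
    (a : P →₀ ℕ) (c : K) : scaleMap K S (monomial a c) =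
      Polynomial.C (monomial a c) * Polynomial.X ^ (∑ i ∈ S, a i) := by
  have h1 : (monomial a c : MvPolynomial P K) = C c * ∏ i, X i ^ a i := by
    rw [monomial_eq, Finsupp.prod_fintype _ _ (by simp)]
  have h2 : ∀ i, scaleMap K S (X i) = Polynomial.C (X i) *
      (if i ∈ S then Polynomial.X else 1) := by
    intro i
    rw [scaleMap, aeval_X]
    split_ifs
    · rw [mul_comm]
    · rw [mul_one]
  have h3 : scaleMap K S (C c) = Polynomial.C (C c) := by
    rw [scaleMap, aeval_C]; rfl
  rw [h1, map_mul, map_prod, h3]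
  simp only [map_pow, h2, mul_pow, Finset.prod_mul_distrib, map_mul, map_prod]
  rw [mul_assoc]
  congr 2
  simp only [ite_pow, one_pow, Finset.prod_ite_mem, Finset.univ_inter, Finset.prod_pow_eq_pow_sum]

lemma coeff_scaleMap {K : Type*} [Field K] {P : Type*} [Fintype P] [DecidableEq P] (S : Finset P)
    (f : MvPolynomial P K) (a : P →₀ ℕ) (d : ℕ) :
    coeff a ((scaleMap K S f).coeff d) = if ∑ i ∈ S, a i = d then coeff a f else 0 := by
  induction f using MvPolynomial.induction_on' with
  | monomial b c =>
    rw [scaleMap_monomial, Polynomial.coeff_C_mul_X_pow, coeff_monomial]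
    by_cases hb : b = a
    · subst hb
      by_cases hd : ∑ i ∈ S, b i = d
      · simp [hd]
      · simp [hd, Ne.symm hd]
    · split_ifs <;> simp [coeff_monomial, hb]
  | add p q hp hq =>
    rw [map_add, Polynomial.coeff_add, coeff_add, hp, hq, coeff_add]
    split_ifs <;> simp

lemma X_pow_dvd_scaleMap {K : Type*} [Field K] {P : Type*} [Fintype P] [DecidableEq P]
    (S : Finset P) (f : MvPolynomial P K) (s : ℕ) :
    Polynomial.X ^ s ∣ scaleMap K S f ↔ ∀ a ∈ f.support, s ≤ ∑ i ∈ S, a i := by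
  rw [Polynomial.X_pow_dvd_iff]
  constructor
  · intro h a ha
    by_contra hlt
    push Not at hlt
    have := coeff_scaleMap S f a (∑ i ∈ S, a i)
    rw [h _ hlt, if_pos rfl, coeff_zero] at this
    exact mem_support_iff.1 ha this.symm
  · intro h d hd
    ext a
    rw [coeff_scaleMap, coeff_zero]
    split_ifs with hS
    · by_contra hne
      have := h a (mem_support_iff.2 hne)
      omega
    · rfl

lemma monomial_bound {K : Type*} [Field K] {P : Type*} [Fintype P]
    [DecidableEq P] [PartialOrder P] (r s : ℕ) (f : MvPolynomial P K)
    (hf : f ∈ symbolicPower (antichainIdeal K P r) s) (a : P →₀ ℕ) (ha : a ∈ f.support)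
    (C : Finset P)
    (hC : ∀ A : Finset P, IsAntichain (· ≤ ·) (A : Set P) → A ⊆ C → A.card ≤ r) :
    s ≤ ∑ i ∈ Cᶜ, a i := by
  classical
  obtain ⟨t, ht, hm⟩ := (mem_symbolicPower_iff _ _ _).1 hf
  set I := antichainIdeal K P r with hI
  let pr : Finset P → Ideal (MvPolynomial P K) := fun S =>
    Ideal.comap (scaleMap K S).toRingHom (Ideal.span {Polynomial.X})
  have hpr : ∀ S g, g ∈ pr S ↔ Polynomial.X ∣ scaleMap K S g := fun S g => by
    simp only [pr, Ideal.mem_comap, Ideal.mem_span_singleton]; rfl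
  have hpr' : ∀ S g, g ∈ pr S ↔ ∀ a ∈ g.support, 1 ≤ ∑ i ∈ S, a i := fun S g => by
    rw [hpr, ← X_pow_dvd_scaleMap, pow_one]
  have hprime : ∀ S, (pr S).IsPrime := fun S => by
    have : (Ideal.span {(Polynomial.X : Polynomial (MvPolynomial P K))}).IsPrime :=
      (Ideal.span_singleton_prime Polynomial.X_ne_zero).2 Polynomial.prime_X
    exact Ideal.IsPrime.comap _
  have hIle : ∀ S : Finset P, (∀ A : Finset P, IsAntichain (· ≤ ·) (A : Set P) → A.card = r + 1 →
      ∃ i ∈ A, i ∈ S) → I ≤ pr S := by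
    intro S hS g hg
    rw [hpr']
    intro b hb
    obtain ⟨A, h1, h2, h3⟩ := (mem_antichainIdeal_iff r g).1 hg b hb
    obtain ⟨i, hiA, hiS⟩ := hS A h1 h2
    exact (h3 i hiA).trans (Finset.single_le_sum (f := fun i => b i) (fun _ _ => Nat.zero_le _) hiS)
  have := hprime Cᶜ
  obtain ⟨q, hq, hqle⟩ := Ideal.exists_minimalPrimes_le (J := pr Cᶜ) (hIle Cᶜ (by
    intro A h1 h2
    by_contra hcon
    push Not at hcon
    have := hC A h1 (fun i hi => by simpa using hcon i hi)
    omega))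
  have hqp : q.IsPrime := hq.1.1
  let S : Finset P := Finset.univ.filter (fun i => (X i : MvPolynomial P K) ∈ q)
  have hSC : S ⊆ Cᶜ := by
    intro i hi
    have h1 := (hpr' _ _).1 (hqle (Finset.mem_filter.1 hi).2) (Finsupp.single i 1)
      (by rw [support_X]; simp)
    by_contra hiC
    rw [Finset.sum_eq_zero] at h1
    · omega
    · intro j hj
      rw [Finsupp.single_apply, if_neg]
      rintro rfl
      exact hiC hj
  have hIS : I ≤ pr S := hIle S (by
    intro A h1 h2
    obtain ⟨i, hi, hX⟩ := hqp.prod_mem_iff.1 (hq.1.2 (prod_mem_antichainIdeal r A h1 h2))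
    exact ⟨i, hi, Finset.mem_filter.2 ⟨Finset.mem_univ _, hX⟩⟩)
  have hSq : pr S ≤ q := by
    intro g hg
    rw [hpr'] at hg
    rw [← support_sum_monomial_coeff g]
    refine Ideal.sum_mem _ fun b hb => ?_
    have h1 := hg b hb
    obtain ⟨i, hi, hne⟩ := Finset.exists_ne_zero_of_sum_ne_zero (show ∑ i ∈ S, b i ≠ 0 by omega)
    refine Ideal.mem_of_dvd _ ?_ (Finset.mem_filter.1 hi).2
    rw [X_dvd_monomial]
    exact Or.inr hne
  have htS : ¬ Polynomial.X ∣ scaleMap K S t := fun h => ht q hq (hSq ((hpr S t).2 h))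
  have hdvd : Polynomial.X ^ s ∣ scaleMap K S t * scaleMap K S f := by
    rw [← map_mul, ← Ideal.mem_span_singleton, ← Ideal.span_singleton_pow]
    have h1 : I ^ s ≤ (pr S) ^ s := Ideal.pow_right_mono hIS s
    exact Ideal.le_comap_pow (scaleMap K S).toRingHom s (h1 hm)
  have := Polynomial.prime_X.pow_dvd_of_dvd_mul_left s htS hdvd
  rw [X_pow_dvd_scaleMap] at this
  exact (this a ha).trans (Finset.sum_le_sum_of_subset hSC)

theorem symbolicPower_antichainIdeal {K : Type*} [Field K] {P : Type*} [Fintype P]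
    [DecidableEq P] [PartialOrder P] (r : ℕ) (hr : 1 ≤ r) (s : ℕ) (hs : 1 ≤ s) :
    symbolicPower (antichainIdeal K P r) s =
      Ideal.span {m | ∃ (l : ℕ) (A : Fin l → Finset P),
        (∀ i, IsAntichain (· ≤ ·) ((A i : Finset P) : Set P) ∧ r + 1 ≤ (A i).card) ∧
        (∑ i, ((A i).card - r)) = s ∧
        m = ∏ i, ∏ j ∈ A i, (X j : MvPolynomial P K)} := by
  apply le_antisymm
  · intro f hf
    rw [← support_sum_monomial_coeff f]
    refine Ideal.sum_mem _ fun a ha => ?_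
    obtain ⟨l, A, hA, hsum, hp⟩ := comb_main r hr s (fun p => a p)
      (fun C hC => monomial_bound r s f hf a ha C hC)
    refine Ideal.mem_of_dvd _ ?_ (Ideal.subset_span ⟨l, A, hA, hsum, rfl⟩)
    have : ∏ i, ∏ j ∈ A i, (X j : MvPolynomial P K) =
        monomial (∑ i, ∑ j ∈ A i, Finsupp.single j 1) 1 := by
      rw [monomial_sum_one]
      exact Finset.prod_congr rfl fun i _ => prod_X_eq_monomial _
    rw [this, monomial_dvd_monomial]
    refine ⟨Or.inr fun p => ?_, one_dvd _⟩
    rw [Finsupp.finsetSum_apply]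
    simp only [sum_single_apply']
    rw [← Finset.card_filter]
    exact hp p
  · rw [Ideal.span_le]
    rintro _ ⟨l, A, hA, hsum, rfl⟩
    choose t ht hm using fun i => gen_mem (K := K) r (A i) (hA i).1
    refine (mem_symbolicPower_iff _ _ _).2 ⟨∏ i, t i, Submonoid.prod_mem _ fun i _ => ht i, ?_⟩
    rw [← Finset.prod_mul_distrib, ← hsum, ← Finset.prod_pow_eq_pow_sum]
    exact Ideal.prod_mem_prod fun i _ => hm i
end
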